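/- arXiv:2412.02123 — 2 statements merged into one kernel-verified Lean document; each statement's English description precedes it below -/
import Mathlib

section
/- Let K = K(n,m,Λ) be a Bedford–McMullen carpet with 2 ≤ N ≤ n−1, let y ∈ π₂(K), and set α = log N / log n. Suppose 0 < H^α(K^y) < ∞, where H^α denotes α-dimensional Hausdorff measure and K^y = { x : (x,y) ∈ K }. If h : ℝ → ℝ is a similitude with similarity ratio ρ ∈ (0,1) (i.e., |h(x) − h(x')| = ρ|x − x'| for all x, x') such that h(K^y) ⊆ K^y, then log ρ / log n is rational. -/
open scoped BigOperators

/-- The Bedford–McMullen carpet `K(n,m,Λ)`: the set of points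
`(Σ_k i_k n^{-k}, Σ_k j_k m^{-k})` with `(i_k, j_k) ∈ Λ` for all `k ≥ 1`. -/
def BMCarpet (n m : ℕ) (Λ : Finset (ℕ × ℕ)) : Set (ℝ × ℝ) :=
  { p | ∃ d : ℕ → ℕ × ℕ, (∀ k, d k ∈ Λ) ∧
      p.1 = ∑' k : ℕ, ((d k).1 : ℝ) / (n : ℝ) ^ (k + 1) ∧
      p.2 = ∑' k : ℕ, ((d k).2 : ℝ) / (m : ℝ) ^ (k + 1) }

/-- `f` is a similitude of the Euclidean plane with ratio `l`. -/
def IsSimilitude (f : ℝ × ℝ → ℝ × ℝ) (l : ℝ) : Prop :=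
  ∀ x y : ℝ × ℝ,
    Real.sqrt (((f x).1 - (f y).1) ^ 2 + ((f x).2 - (f y).2) ^ 2)
      = l * Real.sqrt ((x.1 - y.1) ^ 2 + (x.2 - y.2) ^ 2)

/-- `f` is oblique: both coordinates of `f (1,0) - f (0,0)` are nonzero. -/
def Oblique (f : ℝ × ℝ → ℝ × ℝ) : Prop :=
  (f (1, 0)).1 - (f (0, 0)).1 ≠ 0 ∧ (f (1, 0)).2 - (f (0, 0)).2 ≠ 0

/-- `K` is contained in some affine line of the plane. -/
def OnALine (K : Set (ℝ × ℝ)) : Prop :=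
  ∃ a b c : ℝ, (a ≠ 0 ∨ b ≠ 0) ∧ ∀ p ∈ K, a * p.1 + b * p.2 = c

/-- `I_j`: the digits of selected rectangles in the `j`-th row. -/
def rowDigits (Λ : Finset (ℕ × ℕ)) (j : ℕ) : Finset ℕ :=
  (Λ.filter fun p => p.2 = j).image Prod.fst

/-- `N = max_{0 ≤ j ≤ m-1} card I_j`. -/
def maxRowCard (m : ℕ) (Λ : Finset (ℕ × ℕ)) : ℕ :=
  Finset.sup (Finset.range m) fun j => (rowDigits Λ j).card

/-- The horizontal slice `K^y = { x : (x,y) ∈ K }`. -/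
def horizSlice (K : Set (ℝ × ℝ)) (y : ℝ) : Set ℝ := { x | (x, y) ∈ K }

open MeasureTheory

/-- Positive members of a finite set of reals are bounded away from zero. -/
lemma Set.Finite.exists_pos_le_of_pos {A : Set ℝ} (hA : A.Finite) :
    ∃ η > 0, ∀ x ∈ A, 0 < x → η ≤ x := by
  induction A, hA using Set.Finite.induction_on with
  | empty => exact ⟨1, one_pos, by simp⟩
  | @insert a A _ _ ih =>
    obtain ⟨η, hη, h⟩ := ih
    by_cases ha : 0 < a
    · refine ⟨min a η, lt_min ha hη, ?_⟩
      rintro x (rfl | hx) hx0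
      · exact min_le_left _ _
      · exact (min_le_right _ _).trans (h x hx hx0)
    · refine ⟨η, hη, ?_⟩
      rintro x (rfl | hx) hx0
      · exact absurd hx0 ha
      · exact h x hx hx0

/-- A real function `F` has finitely many rescaled increments `(n ^ l) ^ s * (F (b) - F (a))` over
`n`-adic intervals `[a, b]` of level `l ≥ l₀`. -/
def FiniteAdicIncrements (n l₀ : ℕ) (s : ℝ) (V : Set ℝ) (F : ℝ → ℝ) : Prop :=
  V.Finite ∧ ∀ l ≥ l₀, ∀ a : ℤ,
    ((n : ℝ) ^ l) ^ s * (F ((a + 1) / (n : ℝ) ^ l) - F (a / (n : ℝ) ^ l)) ∈ V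

namespace FiniteAdicIncrements

variable {n l₀ : ℕ} {s : ℝ} {V : Set ℝ} {F : ℝ → ℝ}

lemma exists_finite_multi (hV : FiniteAdicIncrements n l₀ s V F) (B : ℕ) :
    ∃ W : Set ℝ, W.Finite ∧ ∀ l ≥ l₀, ∀ a : ℤ, ∀ b ≤ B,
      ((n : ℝ) ^ l) ^ s * (F ((a + b) / (n : ℝ) ^ l) - F (a / (n : ℝ) ^ l)) ∈ W := by
  induction B with
  | zero =>
    refine ⟨{0}, Set.finite_singleton _, ?_⟩
    intro l _ a b hb
    obtain rfl : b = 0 := by omega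
    simp
  | succ B ih =>
    obtain ⟨W, hW, h⟩ := ih
    refine ⟨W ∪ Set.image2 (· + ·) W V, hW.union (hW.image2 _ hV.1), ?_⟩
    intro l hl a b hb
    rcases Nat.lt_or_ge B b with hb' | hb'
    · obtain rfl : b = B + 1 := by omega
      right
      refine ⟨_, h l hl a B le_rfl, _, hV.2 l hl (a + B), ?_⟩
      push_cast
      ring_nf
    · exact Or.inl (h l hl a b hb')

lemma exists_upper_bound (hV : FiniteAdicIncrements n l₀ s V F) (hn : 2 ≤ n) (hs : 0 < s)
    (hF : Monotone F) :
    ∃ C > 0, ∀ x y : ℝ, x ≤ y → y - x ≤ ((n : ℝ) ^ l₀)⁻¹ → F y - F x ≤ C * (y - x) ^ s := by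
  have hn0 : (0 : ℝ) < n := by positivity
  have hn1 : (1 : ℝ) < n := by exact_mod_cast hn
  obtain ⟨W, hW, h⟩ := hV.exists_finite_multi 2
  obtain ⟨C, hC⟩ := hW.bddAbove
  refine ⟨(max C 1) * (n : ℝ) ^ s, by positivity, ?_⟩
  intro x y hxy hl
  rcases hxy.eq_or_lt with rfl | hlt
  · simp [Real.zero_rpow hs.ne']
  obtain ⟨d, hd⟩ : ∃ d, d = (y - x) * (n : ℝ) ^ l₀ := ⟨_, rfl⟩
  have hd0 : 0 < d := by rw [hd]; have := sub_pos.2 hlt; positivity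
  have hd1 : d ≤ 1 := by
    rw [hd, ← le_div_iff₀ (by positivity), one_div]; exact hl
  obtain ⟨k, hk1, hk2⟩ := exists_nat_pow_near_of_lt_one hd0 hd1 (inv_pos.2 hn0)
    (inv_lt_one_of_one_lt₀ hn1)
  set l := l₀ + k with hldef
  have hyx1 : (y - x) * (n : ℝ) ^ l ≤ 1 := by
    have : (y - x) * (n : ℝ) ^ l = d * n ^ k := by rw [hd, hldef, pow_add]; ring
    rw [this, inv_pow] at *
    calc d * n ^ k ≤ ((n : ℝ) ^ k)⁻¹ * n ^ k := by gcongr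
      _ = 1 := by field_simp
  have hyx2 : 1 ≤ (y - x) * (n : ℝ) ^ l * n := by
    have : (y - x) * (n : ℝ) ^ l * n = d * n ^ (k + 1) := by
      rw [hd, hldef, pow_add, pow_succ]; ring
    rw [this]
    rw [inv_pow] at hk1
    calc (1 : ℝ) = ((n : ℝ) ^ (k + 1))⁻¹ * n ^ (k + 1) := by field_simp
      _ ≤ _ := by gcongr
  have hP : (0 : ℝ) < (n : ℝ) ^ l := by positivity
  have hx : (⌊x * (n : ℝ) ^ l⌋ : ℝ) / (n : ℝ) ^ l ≤ x := by
    rw [div_le_iff₀ hP]; exact Int.floor_le _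
  have hy : y ≤ ((⌊x * (n : ℝ) ^ l⌋ : ℝ) + (2 : ℕ)) / (n : ℝ) ^ l := by
    rw [le_div_iff₀ hP]
    have := Int.lt_floor_add_one (x * (n : ℝ) ^ l)
    push_cast
    nlinarith
  have key := hC (h l (by omega) ⌊x * (n : ℝ) ^ l⌋ 2 le_rfl)
  have hPs : (0 : ℝ) < ((n : ℝ) ^ l) ^ s := by positivity
  have h1 : ((n : ℝ) ^ l) ^ s * (F y - F x) ≤ max C 1 :=
    (mul_le_mul_of_nonneg_left (sub_le_sub (hF hy) (hF hx)) hPs.le).trans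
      (key.trans (le_max_left _ _))
  have h2 : 1 ≤ (y - x) ^ s * ((n : ℝ) ^ l) ^ s * (n : ℝ) ^ s := by
    have hyx := (sub_pos.2 hlt).le
    rw [← Real.mul_rpow hyx hP.le, ← Real.mul_rpow (by positivity) hn0.le]
    exact Real.one_le_rpow hyx2 hs.le
  have h3 : max C 1 ≤ max C 1 * ((y - x) ^ s * ((n : ℝ) ^ l) ^ s * (n : ℝ) ^ s) :=
    le_mul_of_one_le_right (by positivity) h2
  refine le_of_mul_le_mul_left ?_ hPs
  nlinarith

/-- Porosity: an `n`-adic interval contains one, a bounded number of levels below, on which `F` is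
constant. -/
lemma exists_null_subcell (hV : FiniteAdicIncrements n l₀ s V F) (hn : 2 ≤ n)
    (hs1 : s < 1) (hF : Monotone F) :
    ∃ q : ℕ, ∀ l ≥ l₀, ∀ a : ℤ, ∃ a' : ℤ,
      (a : ℝ) / (n : ℝ) ^ l ≤ a' / (n : ℝ) ^ (l + q) ∧
      ((a' : ℝ) + 1) / (n : ℝ) ^ (l + q) ≤ (a + 1) / (n : ℝ) ^ l ∧
      F ((a' + 1) / (n : ℝ) ^ (l + q)) = F (a' / (n : ℝ) ^ (l + q)) := by
  have hn0 : (0 : ℝ) < n := by positivity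
  have hn1 : (1 : ℝ) < n := by exact_mod_cast hn
  obtain ⟨C, hC⟩ := hV.1.bddAbove
  obtain ⟨v, hv0, hv⟩ := hV.1.exists_pos_le_of_pos
  obtain ⟨q, hq⟩ := pow_unbounded_of_one_lt (C / v)
    (Real.one_lt_rpow hn1 (sub_pos.2 hs1))
  refine ⟨q, fun l hl a => ?_⟩
  by_contra! hcon
  have hP : (0 : ℝ) < (n : ℝ) ^ l := by positivity
  have hQ : (0 : ℝ) < (n : ℝ) ^ q := by positivity
  have hR : (0 : ℝ) < ((n : ℝ) ^ (l + q)) ^ s := by positivity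
  have hsub : ∀ i ∈ Finset.range (n ^ q),
      v / ((n : ℝ) ^ (l + q)) ^ s ≤
        F ((a * n ^ q + ((i + 1 : ℕ) : ℝ)) / (n : ℝ) ^ (l + q)) -
          F ((a * n ^ q + (i : ℝ)) / (n : ℝ) ^ (l + q)) := by
    intro i hi
    have hi' : ((i : ℝ) + 1) ≤ (n : ℝ) ^ q := by exact_mod_cast Finset.mem_range.1 hi
    have hne := hcon (a * n ^ q + i)
      (by
        rw [pow_add, div_le_div_iff₀ hP (by positivity)]
        push_cast
        have : (0 : ℝ) ≤ i * n ^ l := by positivity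
        nlinarith)
      (by
        rw [pow_add, div_le_div_iff₀ (by positivity) hP]
        push_cast
        nlinarith)
    have hmem := hV.2 (l + q) (by omega) (a * n ^ q + i)
    push_cast at hne hmem ⊢
    rw [div_le_iff₀ hR, ← add_assoc, mul_comm]
    refine hv _ hmem (mul_pos hR (sub_pos.2 (lt_of_le_of_ne (hF ?_) (Ne.symm hne))))
    exact div_le_div_of_nonneg_right (by linarith) (by positivity)
  have hsum := Finset.sum_le_sum hsub
  rw [Finset.sum_range_sub
    (fun i : ℕ => F ((a * n ^ q + (i : ℝ)) / (n : ℝ) ^ (l + q)))] at hsum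
  have e1 : ((a : ℝ) * n ^ q + ((n ^ q : ℕ) : ℝ)) / (n : ℝ) ^ (l + q) = (a + 1) / (n : ℝ) ^ l := by
    push_cast; rw [pow_add]; field_simp
  have e2 : ((a : ℝ) * n ^ q + ((0 : ℕ) : ℝ)) / (n : ℝ) ^ (l + q) = a / (n : ℝ) ^ l := by
    push_cast; rw [pow_add]; field_simp; ring
  rw [e1, e2, Finset.sum_const, Finset.card_range, nsmul_eq_mul] at hsum
  have hle := hC (hV.2 l hl a)
  have hPs : (0 : ℝ) < ((n : ℝ) ^ l) ^ s := by positivity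
  have h1 := (mul_le_mul_of_nonneg_left hsum hPs.le).trans hle
  have e3 : ((n : ℝ) ^ (1 - s)) ^ q = (n : ℝ) ^ q / ((n : ℝ) ^ q) ^ s := by
    rw [← Real.rpow_natCast, ← Real.rpow_mul hn0.le, mul_comm, Real.rpow_mul hn0.le,
      Real.rpow_natCast, Real.rpow_sub hQ, Real.rpow_one]
  rw [e3, div_lt_iff₀ hv0] at hq
  have e4 : ((n : ℝ) ^ l) ^ s * (((n ^ q : ℕ) : ℝ) * (v / ((n : ℝ) ^ (l + q)) ^ s)) =
      (n : ℝ) ^ q / ((n : ℝ) ^ q) ^ s * v := by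
    rw [pow_add, Real.mul_rpow hP.le hQ.le]
    have : (0 : ℝ) < ((n : ℝ) ^ q) ^ s := by positivity
    push_cast
    field_simp
  linarith

lemma exists_null_cell_between (hV : FiniteAdicIncrements n l₀ s V F) (hn : 2 ≤ n)
    (hs1 : s < 1) (hF : Monotone F) :
    ∃ q : ℕ, ∀ p ≥ l₀, ∀ x y : ℝ, ((n : ℝ) ^ p)⁻¹ ≤ y - x → ∃ a : ℤ,
      x ≤ a / (n : ℝ) ^ (p + q) ∧ ((a : ℝ) + 1) / (n : ℝ) ^ (p + q) ≤ y ∧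
      F ((a + 1) / (n : ℝ) ^ (p + q)) = F (a / (n : ℝ) ^ (p + q)) := by
  have hn0 : (0 : ℝ) < n := by positivity
  obtain ⟨q, hq⟩ := hV.exists_null_subcell hn hs1 hF
  refine ⟨1 + q, fun p hp x y hxy => ?_⟩
  have hP : (0 : ℝ) < (n : ℝ) ^ (p + 1) := by positivity
  obtain ⟨a, h1, h2, h3⟩ := hq (p + 1) (by omega) ⌈x * (n : ℝ) ^ (p + 1)⌉
  rw [← add_assoc]
  refine ⟨a, le_trans ?_ h1, h2.trans ?_, h3⟩
  · rw [le_div_iff₀ hP]; exact Int.le_ceil _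
  · rw [div_le_iff₀ hP]
    have h4 := Int.ceil_lt_add_one (x * (n : ℝ) ^ (p + 1))
    have h5 : (2 : ℝ) ≤ (y - x) * (n : ℝ) ^ (p + 1) := by
      have h6 : ((n : ℝ) ^ p)⁻¹ * (n : ℝ) ^ (p + 1) = n := by
        rw [pow_succ]; field_simp
      have h7 : (2 : ℝ) ≤ n := by exact_mod_cast hn
      nlinarith [mul_le_mul_of_nonneg_right hxy hP.le]
    nlinarith

lemma exists_lt_near (hn : 2 ≤ n) (hF : Monotone F)
    (hne : ∃ x y, F x < F y) :
    ∃ x y, x < y ∧ y - x ≤ ((n : ℝ) ^ l₀)⁻¹ ∧ F x < F y := by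
  by_contra! hcon
  obtain ⟨x, y, hxy⟩ := hne
  have hη : (0 : ℝ) < ((n : ℝ) ^ l₀)⁻¹ := by positivity
  have hstep : ∀ k : ℕ, F (x + k * ((n : ℝ) ^ l₀)⁻¹) ≤ F x := by
    intro k
    induction k with
    | zero => simp
    | succ k ih =>
      refine (hcon _ _ ?_ ?_).trans ih
      · push_cast; linarith
      · push_cast; linarith
  obtain ⟨k, hk⟩ := exists_nat_ge ((y - x) / ((n : ℝ) ^ l₀)⁻¹)
  rw [div_le_iff₀ hη] at hk
  have := hF (show y ≤ x + k * ((n : ℝ) ^ l₀)⁻¹ by linarith)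
  linarith [hstep k]

/-- The optimal constant in the upper regularity bound is attained up to any `ε`. -/
lemma exists_optimal_bound (hV : FiniteAdicIncrements n l₀ s V F) (hn : 2 ≤ n) (hs : 0 < s)
    (hF : Monotone F) (hne : ∃ x y, F x < F y) :
    ∃ M > 0, (∀ x y : ℝ, x ≤ y → y - x ≤ ((n : ℝ) ^ l₀)⁻¹ → F y - F x ≤ M * (y - x) ^ s) ∧
      ∀ ε > 0, ∃ x y : ℝ, x < y ∧ y - x ≤ ((n : ℝ) ^ l₀)⁻¹ ∧
        (1 - ε) * (M * (y - x) ^ s) < F y - F x := by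
  obtain ⟨C, hC0, hC⟩ := hV.exists_upper_bound hn hs hF
  set A : Set ℝ := {r | ∃ x y : ℝ, x < y ∧ y - x ≤ ((n : ℝ) ^ l₀)⁻¹ ∧
    r = (F y - F x) / (y - x) ^ s} with hA
  have hpow : ∀ {x y : ℝ}, x < y → 0 < (y - x) ^ s := fun h => Real.rpow_pos_of_pos (sub_pos.2 h) s
  have hbdd : BddAbove A := by
    refine ⟨C, ?_⟩
    rintro r ⟨x, y, hxy, hl, rfl⟩
    rw [div_le_iff₀ (hpow hxy)]
    exact hC x y hxy.le hl
  obtain ⟨x₀, y₀, hxy₀, hl₀, hlt₀⟩ := exists_lt_near (l₀ := l₀) hn hF hne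
  have hmem₀ : (F y₀ - F x₀) / (y₀ - x₀) ^ s ∈ A := ⟨x₀, y₀, hxy₀, hl₀, rfl⟩
  have hM : 0 < sSup A :=
    (div_pos (sub_pos.2 hlt₀) (hpow hxy₀)).trans_le (le_csSup hbdd hmem₀)
  refine ⟨sSup A, hM, ?_, ?_⟩
  · intro x y hxy hl
    rcases hxy.eq_or_lt with rfl | hlt
    · simp [Real.zero_rpow hs.ne']
    · rw [← div_le_iff₀ (hpow hlt)]
      exact le_csSup hbdd ⟨x, y, hlt, hl, rfl⟩
  · intro ε hε
    obtain ⟨r, ⟨x, y, hxy, hl, rfl⟩, hr⟩ :=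
      exists_lt_of_lt_csSup ⟨_, hmem₀⟩ (show (1 - ε) * sSup A < sSup A by nlinarith)
    refine ⟨x, y, hxy, hl, ?_⟩
    rw [lt_div_iff₀ (hpow hxy)] at hr
    linarith

set_option maxHeartbeats 1000000 in
/-- If `x ↦ r x + c` does not decrease `s`-dimensional mass, where `t = r n ^ e ∈ [1, n]`, then
comparing a nearly optimal interval with its image shows that `t ^ s` is a quotient of two rescaled
increments from a finite set which does not depend on `r`. -/
lemma exists_ratio_set (hV : FiniteAdicIncrements n l₀ s V F) (hn : 2 ≤ n) (hs : 0 < s)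
    (hs1 : s < 1) (hF : Monotone F) (hne : ∃ x y, F x < F y) :
    ∃ W : Set ℝ, W.Finite ∧ ∀ (r c : ℝ) (e : ℕ), 0 < r → r ≤ 1 → 1 ≤ r * (n : ℝ) ^ e →
      r * (n : ℝ) ^ e ≤ n →
      (∀ x y, x ≤ y → r ^ s * (F y - F x) ≤ F (r * y + c) - F (r * x + c)) →
      ∃ w ∈ W, ∃ w' ∈ W, (r * (n : ℝ) ^ e) ^ s = w' / w := by
  have hn0 : (0 : ℝ) < n := by positivity
  have hn1 : (1 : ℝ) < n := by exact_mod_cast hn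
  obtain ⟨M, hM0, hM, hopt⟩ := hV.exists_optimal_bound hn hs hF hne
  obtain ⟨q, hq⟩ := hV.exists_null_cell_between hn hs1 hF
  obtain ⟨δ, hδ0, hδ4, hδs⟩ : ∃ δ : ℝ, 0 < δ ∧ δ ≤ 1 / 4 ∧ δ ^ s ≤ 1 / 8 := by
    refine ⟨min (1 / 4) ((1 / 8) ^ s⁻¹), by positivity, min_le_left _ _, ?_⟩
    calc (min (1 / 4 : ℝ) ((1 / 8) ^ s⁻¹)) ^ s ≤ ((1 / 8 : ℝ) ^ s⁻¹) ^ s :=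
          Real.rpow_le_rpow (by positivity) (min_le_right _ _) hs.le
      _ = 1 / 8 := by
          rw [← Real.rpow_mul (by norm_num), inv_mul_cancel₀ hs.ne', Real.rpow_one]
  obtain ⟨B, hB⟩ := exists_nat_ge ((n : ℝ) ^ (q + 2) / δ)
  obtain ⟨W, hWfin, hW⟩ := hV.exists_finite_multi B
  refine ⟨W, hWfin, fun r c e hr0 hr1 ht1 htn hemb => ?_⟩
  obtain ⟨t, ht⟩ : ∃ t, t = r * (n : ℝ) ^ e := ⟨_, rfl⟩
  rw [← ht] at ht1 htn ⊢
  by_contra! hcon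
  have ht0 : 0 < t := by linarith
  have hts : 0 < t ^ s := Real.rpow_pos_of_pos ht0 s
  obtain ⟨η, hη0, hη⟩ := (hWfin.image2 (fun w w' => w' - t ^ s * w) hWfin).exists_pos_le_of_pos
  have hBs : 0 < max (B : ℝ) 1 ^ s := by positivity
  obtain ⟨ε, hε0, hε2, hεη⟩ : ∃ ε : ℝ, 0 < ε ∧ ε ≤ 1 / 2 ∧
      ε * (t ^ s * M * max (B : ℝ) 1 ^ s) < η := by
    have hD : 0 < t ^ s * M * max (B : ℝ) 1 ^ s := by positivity
    refine ⟨min (1 / 2) (η / (t ^ s * M * max (B : ℝ) 1 ^ s) / 2), by positivity,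
      min_le_left _ _, ?_⟩
    calc _ ≤ (η / (t ^ s * M * max (B : ℝ) 1 ^ s) / 2) * (t ^ s * M * max (B : ℝ) 1 ^ s) := by
          gcongr; exact min_le_right _ _
      _ = η / 2 := by field_simp
      _ < η := by linarith
  obtain ⟨x, y, hxy, hyl, hJ⟩ := hopt ε hε0
  obtain ⟨ℓ, hℓ⟩ : ∃ ℓ, ℓ = y - x := ⟨_, rfl⟩
  rw [← hℓ] at hyl hJ
  have hℓ0 : 0 < ℓ := by rw [hℓ]; linarith
  have hℓs : 0 < ℓ ^ s := Real.rpow_pos_of_pos hℓ0 s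
  have hη1 : ((n : ℝ) ^ l₀)⁻¹ ≤ 1 := inv_le_one_of_one_le₀ (one_le_pow₀ hn1.le)
  have hδℓ4 : δ * ℓ ≤ 1 / 4 * ℓ := by gcongr
  have hδℓ : δ * ℓ ≤ ℓ := by linarith
  have hδℓ0 : 0 < δ * ℓ := mul_pos hδ0 hℓ0
  obtain ⟨p', hp1, hp2⟩ := exists_nat_pow_near_of_lt_one (mul_pos hδ0 hℓ0)
    (hδℓ.trans (hyl.trans hη1)) (inv_pos.2 hn0) (inv_lt_one_of_one_lt₀ hn1)
  obtain ⟨p, hp⟩ : ∃ p, p = p' + 1 := ⟨_, rfl⟩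
  rw [inv_pow, ← hp] at hp1
  have hp2' : δ * ℓ * (n : ℝ) ^ p ≤ n := by
    rw [hp, pow_succ]
    rw [inv_pow] at hp2
    calc δ * ℓ * ((n : ℝ) ^ p' * n) ≤ ((n : ℝ) ^ p')⁻¹ * ((n : ℝ) ^ p' * n) := by gcongr
      _ = n := by field_simp
  have hpl : l₀ ≤ p := by
    have : ((n : ℝ) ^ p)⁻¹ < ((n : ℝ) ^ l₀)⁻¹ := hp1.trans_le (hδℓ.trans hyl)
    rw [inv_lt_inv₀ (by positivity) (by positivity)] at this
    exact ((pow_lt_pow_iff_right₀ hn1).1 this).le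
  obtain ⟨a₁, ha1, ha1', ha1F⟩ := hq p hpl x (x + δ * ℓ) (by linarith)
  obtain ⟨a₂, ha2, ha2', ha2F⟩ := hq p hpl (y - δ * ℓ) y (by linarith)
  set g := p + q with hg
  have hG : (0 : ℝ) < (n : ℝ) ^ g := by positivity
  have hGs : (0 : ℝ) < ((n : ℝ) ^ g) ^ s := by positivity
  have hℓG : ℓ * (n : ℝ) ^ g * n ≤ B := by
    refine le_trans ?_ hB
    rw [le_div_iff₀ hδ0, hg, pow_add, pow_add]
    calc ℓ * ((n : ℝ) ^ p * n ^ q) * n * δ = (δ * ℓ * n ^ p) * (n ^ q * n) := by ring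
      _ ≤ n * (n ^ q * n) := by gcongr
      _ = _ := by ring
  have hℓG' : ℓ * (n : ℝ) ^ g ≤ B :=
    (le_mul_of_one_le_right (by positivity) hn1.le).trans hℓG
  have h12 : ((a₁ : ℝ) + 1) / (n : ℝ) ^ g ≤ a₂ / (n : ℝ) ^ g := by linarith
  have h12' : a₁ + 1 ≤ a₂ := by
    have := (div_le_div_iff_of_pos_right hG).1 h12
    exact_mod_cast this
  -- the mass between the two null cells
  have hleft : F ((a₁ + 1) / (n : ℝ) ^ g) - F x ≤ M * ℓ ^ s / 8 := by
    have h1 := hF ha1'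
    have h2 := hM x (x + δ * ℓ) (by linarith) (by linarith)
    rw [add_sub_cancel_left, Real.mul_rpow hδ0.le hℓ0.le] at h2
    have : M * (δ ^ s * ℓ ^ s) ≤ M * (1 / 8 * ℓ ^ s) := by gcongr
    linarith
  have hright : F y - F (a₂ / (n : ℝ) ^ g) ≤ M * ℓ ^ s / 8 := by
    have h1 := hF ha2
    have h2 := hM (y - δ * ℓ) y (by linarith) (by linarith)
    rw [sub_sub_cancel, Real.mul_rpow hδ0.le hℓ0.le] at h2
    have : M * (δ ^ s * ℓ ^ s) ≤ M * (1 / 8 * ℓ ^ s) := by gcongr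
    linarith
  have hCpos : 0 < F (a₂ / (n : ℝ) ^ g) - F ((a₁ + 1) / (n : ℝ) ^ g) := by
    have h1 : 0 < M * ℓ ^ s := by positivity
    have h2 : 1 / 2 * (M * ℓ ^ s) ≤ (1 - ε) * (M * ℓ ^ s) := by gcongr; linarith
    linarith
  obtain ⟨b, hb⟩ := Int.le.dest h12'
  have hbR : (a₂ : ℝ) = (a₁ : ℝ) + 1 + b := by rw [← hb]; push_cast; ring
  have hw := hW g (by omega) (a₁ + 1) b (by
    have h1 : (a₂ : ℝ) / (n : ℝ) ^ g - a₁ / (n : ℝ) ^ g ≤ ℓ := by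
      have : (a₂ : ℝ) / (n : ℝ) ^ g ≤ (a₂ + 1) / (n : ℝ) ^ g := by gcongr; linarith
      linarith
    rw [← sub_div, div_le_iff₀ hG] at h1
    have : (b : ℝ) ≤ B := by linarith
    exact_mod_cast this)
  push_cast at hw
  rw [← hbR] at hw
  -- the image of the configuration
  obtain ⟨L, hL⟩ : ∃ L, L = g + e := ⟨_, rfl⟩
  have hLP : (0 : ℝ) < (n : ℝ) ^ L := by positivity
  have hrL : r * (n : ℝ) ^ L = t * (n : ℝ) ^ g := by rw [hL, pow_add, ht]; ring
  have hboundary : ∀ a : ℤ, ∃ d : ℤ, d = ⌈(r * (a / (n : ℝ) ^ g) + c) * (n : ℝ) ^ L⌉ ∧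
      r * (a / (n : ℝ) ^ g) + c ≤ d / (n : ℝ) ^ L ∧
      d / (n : ℝ) ^ L ≤ r * ((a + 1) / (n : ℝ) ^ g) + c := by
    intro a
    refine ⟨_, rfl, ?_, ?_⟩
    · rw [le_div_iff₀ hLP]; exact Int.le_ceil _
    · rw [div_le_iff₀ hLP]
      refine (Int.ceil_lt_add_one _).le.trans ?_
      have : (r * ((a + 1) / (n : ℝ) ^ g) + c) * (n : ℝ) ^ L =
          (r * (a / (n : ℝ) ^ g) + c) * (n : ℝ) ^ L + t := by
        have : t = r * (n : ℝ) ^ L / (n : ℝ) ^ g := by rw [hrL]; field_simp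
        rw [this]; ring
      linarith
  obtain ⟨d₁, hd1, hd1l, hd1u⟩ := hboundary a₁
  obtain ⟨d₂, hd2, hd2l, hd2u⟩ := hboundary a₂
  have hmap : ∀ {u v : ℝ}, u ≤ v → r * u + c ≤ r * v + c := fun h => by gcongr
  have hd12 : d₁ ≤ d₂ := by
    have : (d₁ : ℝ) / (n : ℝ) ^ L ≤ d₂ / (n : ℝ) ^ L := hd1u.trans ((hmap h12).trans hd2l)
    exact_mod_cast (div_le_div_iff_of_pos_right hLP).1 this
  obtain ⟨b', hb'⟩ := Int.le.dest hd12
  have hbR' : (d₂ : ℝ) = (d₁ : ℝ) + b' := by rw [← hb']; push_cast; ring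
  have hw' := hW L (by omega) d₁ b' (by
    have h1 : (d₂ : ℝ) / (n : ℝ) ^ L - d₁ / (n : ℝ) ^ L ≤ r * ℓ := by
      have h3 := hmap ha2'
      have h4 := hmap ha1
      rw [hℓ]
      linarith
    rw [← sub_div, div_le_iff₀ hLP] at h1
    have : (b' : ℝ) ≤ B := by
      calc (b' : ℝ) ≤ r * ℓ * (n : ℝ) ^ L := by linarith
        _ = t * (ℓ * (n : ℝ) ^ g) := by rw [mul_right_comm, hrL]; ring
        _ ≤ n * (ℓ * (n : ℝ) ^ g) := by gcongr
        _ ≤ B := by linarith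
    exact_mod_cast this)
  rw [← hbR'] at hw'
  have hrs : 0 < r ^ s := Real.rpow_pos_of_pos hr0 s
  have hscale : ((n : ℝ) ^ L) ^ s * r ^ s = t ^ s * ((n : ℝ) ^ g) ^ s := by
    rw [← Real.mul_rpow hLP.le hr0.le, ← Real.mul_rpow ht0.le hG.le, mul_comm, hrL]
  have hLs : 0 < ((n : ℝ) ^ L) ^ s := by positivity
  -- lower bound
  have hlow : r ^ s * (F (a₂ / (n : ℝ) ^ g) - F ((a₁ + 1) / (n : ℝ) ^ g)) ≤
      F (d₂ / (n : ℝ) ^ L) - F (d₁ / (n : ℝ) ^ L) := by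
    have h1 := hemb _ _ h12
    have h2 := hF hd1u
    have h3 := hF hd2l
    linarith
  -- upper bound
  have hup : F (d₂ / (n : ℝ) ^ L) - F (d₁ / (n : ℝ) ^ L) ≤
      r ^ s * (F (a₂ / (n : ℝ) ^ g) - F ((a₁ + 1) / (n : ℝ) ^ g)) +
        r ^ s * (ε * (M * ℓ ^ s)) := by
    have h1 := hemb _ _ ha1
    have h2 := hemb _ _ ha2'
    have h3 := hF hd1l
    have h4 := hF hd2u
    have h6 : r * y + c - (r * x + c) = r * ℓ := by rw [hℓ]; ring
    have h5 := hM (r * x + c) (r * y + c) (hmap hxy.le)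
      (by rw [h6]; exact (mul_le_of_le_one_left hℓ0.le hr1).trans hyl)
    rw [h6, Real.mul_rpow hr0.le hℓ0.le] at h5
    rw [ha2F] at h2
    rw [← ha1F] at h1
    have h7 := mul_lt_mul_of_pos_left hJ hrs
    linear_combination h1 + h2 + h3 + h4 + h5 + h7.le
  set w := ((n : ℝ) ^ g) ^ s * (F (a₂ / (n : ℝ) ^ g) - F ((a₁ + 1) / (n : ℝ) ^ g)) with hwdef
  set w' := ((n : ℝ) ^ L) ^ s * (F (d₂ / (n : ℝ) ^ L) - F (d₁ / (n : ℝ) ^ L)) with hwdef'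
  have hw0 : 0 < w := mul_pos hGs hCpos
  have hlow' : t ^ s * w ≤ w' := by
    have := mul_le_mul_of_nonneg_left hlow hLs.le
    rw [← mul_assoc, hscale] at this
    rw [hwdef, ← mul_assoc]; exact this
  have hup' : w' ≤ t ^ s * w + ε * (t ^ s * M * max (B : ℝ) 1 ^ s) := by
    have h1 := mul_le_mul_of_nonneg_left hup hLs.le
    rw [mul_add, ← mul_assoc, ← mul_assoc, hscale] at h1
    have h2 : ℓ ^ s * ((n : ℝ) ^ g) ^ s ≤ max (B : ℝ) 1 ^ s := by
      rw [← Real.mul_rpow hℓ0.le hG.le]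
      exact Real.rpow_le_rpow (by positivity) (hℓG'.trans (le_max_left _ _)) hs.le
    have h3 : t ^ s * ((n : ℝ) ^ g) ^ s * (ε * (M * ℓ ^ s)) ≤
        ε * (t ^ s * M * max (B : ℝ) 1 ^ s) := by
      calc _ = ε * (t ^ s * M * (ℓ ^ s * ((n : ℝ) ^ g) ^ s)) := by ring
        _ ≤ _ := by gcongr
    have h4 : t ^ s * w = t ^ s * ((n : ℝ) ^ g) ^ s *
        (F (a₂ / (n : ℝ) ^ g) - F ((a₁ + 1) / (n : ℝ) ^ g)) := by rw [hwdef]; ring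
    linarith
  have hne' : t ^ s * w ≠ w' := fun h => hcon w hw w' hw' (by rw [← h]; field_simp)
  have := hη _ (Set.mem_image2_of_mem hw hw') (by
    have := lt_of_le_of_ne hlow' hne'
    linarith)
  linarith

/-- A function with finitely many rescaled `n`-adic increments which admits self-embeddings of
ratios `ρ ^ k` must have `ρ` multiplicatively commensurable with `n`. -/
theorem log_div_log_rational (hV : FiniteAdicIncrements n l₀ s V F) (hn : 2 ≤ n) (hs : 0 < s)
    (hs1 : s < 1) (hF : Monotone F) (hne : ∃ x y, F x < F y) {ρ : ℝ} (hρ0 : 0 < ρ) (hρ1 : ρ < 1)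
    (hemb : ∀ k : ℕ, ∃ c, ∀ x y, x ≤ y →
      (ρ ^ k) ^ s * (F y - F x) ≤ F (ρ ^ k * y + c) - F (ρ ^ k * x + c)) :
    ∃ q : ℚ, Real.log ρ / Real.log n = q := by
  have hn0 : (0 : ℝ) < n := by positivity
  have hn1 : (1 : ℝ) < n := by exact_mod_cast hn
  obtain ⟨W, hWfin, hW⟩ := hV.exists_ratio_set hn hs hs1 hF hne
  have hnorm : ∀ k : ℕ, ∃ e : ℕ, 1 ≤ ρ ^ k * (n : ℝ) ^ e ∧ ρ ^ k * (n : ℝ) ^ e ≤ n := by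
    intro k
    obtain ⟨e, h1, h2⟩ := exists_nat_pow_near_of_lt_one (pow_pos hρ0 k)
      (pow_le_one₀ hρ0.le hρ1.le) (inv_pos.2 hn0) (inv_lt_one_of_one_lt₀ hn1)
    rw [inv_pow] at h1 h2
    refine ⟨e + 1, ?_, ?_⟩
    · calc (1 : ℝ) = ((n : ℝ) ^ (e + 1))⁻¹ * (n : ℝ) ^ (e + 1) := by field_simp
        _ ≤ _ := by gcongr
    · calc ρ ^ k * (n : ℝ) ^ (e + 1) ≤ ((n : ℝ) ^ e)⁻¹ * (n : ℝ) ^ (e + 1) := by gcongr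
        _ = n := by rw [pow_succ]; field_simp
  choose e he1 hen using hnorm
  have hmem : ∀ k, (ρ ^ k * (n : ℝ) ^ e k) ^ s ∈ Set.image2 (fun w w' => w' / w) W W := by
    intro k
    obtain ⟨c, hc⟩ := hemb k
    obtain ⟨w, hw, w', hw', h⟩ := hW (ρ ^ k) c (e k) (pow_pos hρ0 k)
      (pow_le_one₀ hρ0.le hρ1.le) (he1 k) (hen k) hc
    exact ⟨w, hw, w', hw', h.symm⟩
  obtain ⟨k, -, k', -, hkk, heq⟩ := Set.infinite_univ.exists_ne_map_eq_of_mapsTo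
    (fun k _ => hmem k) (hWfin.image2 _ hWfin)
  have heq' : ρ ^ k * (n : ℝ) ^ e k = ρ ^ k' * (n : ℝ) ^ e k' :=
    (Real.rpow_left_inj (by positivity) (by positivity) hs.ne').1 heq
  have hlog := congrArg Real.log heq'
  rw [Real.log_mul (by positivity) (by positivity), Real.log_mul (by positivity) (by positivity),
    Real.log_pow, Real.log_pow, Real.log_pow, Real.log_pow] at hlog
  refine ⟨((e k' : ℚ) - e k) / ((k : ℚ) - k'), ?_⟩
  have hk0 : (k : ℝ) - k' ≠ 0 := sub_ne_zero.2 (by exact_mod_cast hkk)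
  have hl0 : Real.log n ≠ 0 := (Real.log_pos hn1).ne'
  push_cast
  rw [div_eq_div_iff hl0 hk0]
  linarith

end FiniteAdicIncrements

/-- The real number with base-`n` digits `i 0, i 1, …` after the radix point. -/
noncomputable def adicValue (n : ℕ) (i : ℕ → ℕ) : ℝ := ∑' k, (i k : ℝ) / (n : ℝ) ^ (k + 1)

/-- The natural number with base-`n` digits `i 0, …, i (l - 1)`. -/
def adicLeading (n : ℕ) (i : ℕ → ℕ) : ℕ → ℕ
  | 0 => 0
  | l + 1 => n * adicLeading n i l + i l

section Digits

variable {n : ℕ} {i : ℕ → ℕ}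

lemma hasSum_adic_geometric (hn : 2 ≤ n) :
    HasSum (fun k : ℕ => ((n : ℝ) - 1) / (n : ℝ) ^ (k + 1)) 1 := by
  have hn1 : (1 : ℝ) < n := by exact_mod_cast hn
  have h := (hasSum_geometric_of_lt_one (r := (n : ℝ)⁻¹) (by positivity)
    (inv_lt_one_of_one_lt₀ hn1)).mul_left (((n : ℝ) - 1) / n)
  have h1 : ((n : ℝ) - 1) / n * (1 - (n : ℝ)⁻¹)⁻¹ = 1 := by
    have : (n : ℝ) - 1 ≠ 0 := by linarith
    field_simp
  rw [h1] at h
  have h2 : (fun k : ℕ => ((n : ℝ) - 1) / (n : ℝ) ^ (k + 1)) =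
      fun k => ((n : ℝ) - 1) / n * (n : ℝ)⁻¹ ^ k := by
    funext k
    rw [pow_succ, inv_pow]
    field_simp
  rwa [h2]

lemma adic_term_le (hn : 2 ≤ n) (hi : ∀ k, i k < n) (k : ℕ) :
    (i k : ℝ) / (n : ℝ) ^ (k + 1) ≤ ((n : ℝ) - 1) / (n : ℝ) ^ (k + 1) := by
  have : (i k : ℝ) + 1 ≤ n := by exact_mod_cast hi k
  gcongr
  linarith

lemma summable_adic (hn : 2 ≤ n) (hi : ∀ k, i k < n) :
    Summable fun k => (i k : ℝ) / (n : ℝ) ^ (k + 1) :=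
  (hasSum_adic_geometric hn).summable.of_nonneg_of_le (fun k => by positivity) (adic_term_le hn hi)

lemma adicValue_nonneg : 0 ≤ adicValue n i := tsum_nonneg fun k => by positivity

lemma adicValue_le_one (hn : 2 ≤ n) (hi : ∀ k, i k < n) : adicValue n i ≤ 1 :=
  ((summable_adic hn hi).tsum_le_tsum (adic_term_le hn hi)
    (hasSum_adic_geometric hn).summable).trans_eq (hasSum_adic_geometric hn).tsum_eq

lemma adicValue_step (hn : 2 ≤ n) (hi : ∀ k, i k < n) :
    adicValue n i = (i 0 + adicValue n fun k => i (k + 1)) / n := by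
  have hn0 : (0 : ℝ) < n := by positivity
  rw [adicValue, (summable_adic hn hi).tsum_eq_zero_add, add_div, adicValue, ← tsum_div_const]
  simp only [zero_add, pow_one, add_right_inj]
  refine tsum_congr fun k => ?_
  rw [pow_succ _ (k + 1), div_div]

lemma adicValue_eq_add_div (hn : 2 ≤ n) (hi : ∀ k, i k < n) (l : ℕ) :
    adicValue n i = (adicLeading n i l + adicValue n fun k => i (k + l)) / (n : ℝ) ^ l := by
  have hn0 : (0 : ℝ) < n := by positivity
  induction l with
  | zero => simp [adicLeading]
  | succ l ih =>
    rw [ih, adicValue_step hn (i := fun k => i (k + l)) (fun k => hi _), adicLeading, pow_succ]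
    simp only [zero_add, add_right_comm _ 1 l, ← add_assoc]
    push_cast
    field_simp
    ring

lemma eq_zero_of_adicValue_eq_zero (hn : 2 ≤ n) (hi : ∀ k, i k < n) (h : adicValue n i = 0) :
    i = fun _ => 0 := by
  have hn0 : (0 : ℝ) < n := by positivity
  have hz := (hasSum_zero_iff_of_nonneg (fun k => by positivity)).1
    ((summable_adic hn hi).hasSum_iff.2 h)
  funext k
  have := congrFun hz k
  simp only [Pi.zero_apply, div_eq_zero_iff, Nat.cast_eq_zero] at this
  exact this.resolve_right (by positivity)

lemma eq_pred_of_adicValue_eq_one (hn : 2 ≤ n) (hi : ∀ k, i k < n) (h : adicValue n i = 1) :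
    i = fun _ => n - 1 := by
  have hn0 : (0 : ℝ) < n := by positivity
  have hz := (hasSum_zero_iff_of_nonneg
    (fun k => sub_nonneg.2 (adic_term_le hn hi k))).1
    (by simpa using (hasSum_adic_geometric hn).sub ((summable_adic hn hi).hasSum_iff.2 h))
  funext k
  have := congrFun hz k
  simp only [Pi.zero_apply, ← sub_div, div_eq_zero_iff] at this
  have h2 := this.resolve_right (by positivity)
  have h3 : (n : ℝ) = ((i k + 1 : ℕ) : ℝ) := by push_cast; linarith
  have h4 : n = i k + 1 := by exact_mod_cast h3
  omega

lemma adicLeading_congr {i' : ℕ → ℕ} {l : ℕ} (h : ∀ k < l, i k = i' k) :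
    adicLeading n i l = adicLeading n i' l := by
  induction l with
  | zero => rfl
  | succ l ih =>
    rw [adicLeading, adicLeading, ih fun k hk => h k (by omega), h l (by omega)]

end Digits

/-- Base-`m` expansions of a fixed real number: either there is at most one, or all their tails
are eventually `0, 0, …` or `m - 1, m - 1, …`. -/
lemma adicValue_fiber_dichotomy {m : ℕ} (hm : 2 ≤ m) (y : ℝ) :
    Set.Subsingleton {j : ℕ → ℕ | (∀ k, j k < m) ∧ adicValue m j = y} ∨
    ∃ l₀, ∀ l ≥ l₀, ∀ j : ℕ → ℕ, (∀ k, j k < m) → adicValue m j = y →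
      (fun k => j (k + l)) = (fun _ => 0) ∨ (fun k => j (k + l)) = fun _ => m - 1 := by
  have hm0 : (0 : ℝ) < m := by positivity
  have hpre : ∀ j : ℕ → ℕ, (∀ k, j k < m) → adicValue m j = y → ∀ l,
      y * (m : ℝ) ^ l = adicLeading m j l + adicValue m fun k => j (k + l) := by
    rintro j hj rfl l
    rw [adicValue_eq_add_div hm hj l]
    field_simp
  by_cases hint : ∃ (l₀ : ℕ) (z : ℤ), y * (m : ℝ) ^ l₀ = z
  · right
    obtain ⟨l₀, z, hz⟩ := hint
    refine ⟨l₀, fun l hl j hj hy => ?_⟩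
    obtain ⟨e, rfl⟩ := Nat.exists_eq_add_of_le hl
    have h1 := hpre j hj hy (l₀ + e)
    rw [pow_add, ← mul_assoc, hz] at h1
    have hj' : ∀ k, j (k + (l₀ + e)) < m := fun k => hj _
    have h2 : adicValue m (fun k => j (k + (l₀ + e))) =
        ((z * m ^ e - adicLeading m j (l₀ + e) : ℤ) : ℝ) := by
      push_cast; linarith
    have h3 := adicValue_nonneg (n := m) (i := fun k => j (k + (l₀ + e)))
    have h4 := adicValue_le_one hm hj'
    obtain ⟨c, hc⟩ : ∃ c : ℤ, c = z * m ^ e - adicLeading m j (l₀ + e) := ⟨_, rfl⟩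
    rw [← hc] at h2
    rw [h2] at h3 h4
    have h5 : 0 ≤ c := by exact_mod_cast h3
    have h6 : c ≤ 1 := by exact_mod_cast h4
    obtain rfl | rfl : c = 0 ∨ c = 1 := by omega
    · exact Or.inl (eq_zero_of_adicValue_eq_zero hm hj' (by simpa using h2))
    · exact Or.inr (eq_pred_of_adicValue_eq_one hm hj' (by simpa using h2))
  · left
    push Not at hint
    have hfloor : ∀ j : ℕ → ℕ, (∀ k, j k < m) → adicValue m j = y → ∀ l,
        ⌊y * (m : ℝ) ^ l⌋ = adicLeading m j l := by
      intro j hj hy l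
      have h1 := hpre j hj hy l
      have h2 := adicValue_le_one hm (i := fun k => j (k + l)) (fun k => hj _)
      rw [Int.floor_eq_iff, h1]
      refine ⟨by simpa using adicValue_nonneg, ?_⟩
      have h3 : adicValue m (fun k => j (k + l)) ≠ 1 := by
        intro h
        refine hint l (adicLeading m j l + 1) ?_
        rw [h1, h]; push_cast; ring
      have := lt_of_le_of_ne h2 h3
      push_cast
      linarith
    rintro j ⟨hj, hjy⟩ j' ⟨hj', hjy'⟩
    have hp : ∀ l, adicLeading m j l = adicLeading m j' l := fun l => by
      have := (hfloor j hj hjy l).symm.trans (hfloor j' hj' hjy' l)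
      exact_mod_cast this
    funext k
    have h1 := hp (k + 1)
    rw [adicLeading, adicLeading, hp k] at h1
    omega

/-- The set of reals with a base-`n` digit sequence in `D`. -/
def adicSet (n : ℕ) (D : Set (ℕ → ℕ)) : Set ℝ := adicValue n '' D

/-- The tails of the digit sequences in `D` whose first `l` digits form the integer `a`. -/
def adicTails (n : ℕ) (D : Set (ℕ → ℕ)) (l : ℕ) (a : ℤ) : Set (ℕ → ℕ) :=
  {t | ∃ i ∈ D, (adicLeading n i l : ℤ) = a ∧ t = fun k => i (k + l)}

section AdicSet

variable {n : ℕ} {D : Set (ℕ → ℕ)}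

lemma adicSet_subset_Icc (hn : 2 ≤ n) (hD : ∀ i ∈ D, ∀ k, i k < n) :
    adicSet n D ⊆ Set.Icc 0 1 := by
  rintro _ ⟨i, hi, rfl⟩
  exact ⟨adicValue_nonneg, adicValue_le_one hn (hD i hi)⟩

lemma adicTails_lt (hD : ∀ i ∈ D, ∀ k, i k < n) (l : ℕ) (a : ℤ) :
    ∀ i ∈ adicTails n D l a, ∀ k, i k < n := by
  rintro _ ⟨i, hi, -, rfl⟩ k
  exact hD i hi _

lemma Ioo_inter_adicSet (hn : 2 ≤ n) (hD : ∀ i ∈ D, ∀ k, i k < n) (l : ℕ) (a : ℤ) :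
    Set.Ioo ((a : ℝ) / (n : ℝ) ^ l) ((a + 1) / (n : ℝ) ^ l) ∩ adicSet n D =
      (fun z => ((n : ℝ) ^ l)⁻¹ * z + a / (n : ℝ) ^ l) ''
        (Set.Ioo 0 1 ∩ adicSet n (adicTails n D l a)) := by
  have hP : (0 : ℝ) < (n : ℝ) ^ l := by positivity
  ext x
  constructor
  · rintro ⟨⟨h1, h2⟩, i, hi, rfl⟩
    have h3 := adicValue_eq_add_div hn (hD i hi) l
    have h4 := adicValue_nonneg (n := n) (i := fun k => i (k + l))
    have h5 := adicValue_le_one hn (i := fun k => i (k + l)) (fun k => hD i hi _)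
    rw [h3, div_lt_div_iff_of_pos_right hP] at h1 h2
    have h6 : (adicLeading n i l : ℤ) = a := by
      have h7 : (a : ℝ) < (adicLeading n i l : ℤ) + 1 := by push_cast; linarith
      have h8 : ((adicLeading n i l : ℤ) : ℝ) < a + 1 := by push_cast; linarith
      have h7' : a < (adicLeading n i l : ℤ) + 1 := by exact_mod_cast h7
      have h8' : (adicLeading n i l : ℤ) < a + 1 := by exact_mod_cast h8
      omega
    have h6' : (adicLeading n i l : ℝ) = a := by exact_mod_cast h6
    rw [h6'] at h1 h2 h3
    refine ⟨_, ⟨⟨?_, ?_⟩, _, ⟨i, hi, h6, rfl⟩, rfl⟩, ?_⟩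
    · linarith
    · linarith
    · rw [h3]; ring
  · rintro ⟨_, ⟨⟨h1, h2⟩, _, ⟨i, hi, h6, rfl⟩, rfl⟩, rfl⟩
    have h6' : (adicLeading n i l : ℝ) = a := by exact_mod_cast h6
    have h3 := adicValue_eq_add_div hn (hD i hi) l
    rw [h6'] at h3
    have h4 : ((n : ℝ) ^ l)⁻¹ * adicValue n (fun k => i (k + l)) + a / (n : ℝ) ^ l =
        adicValue n i := by rw [h3]; ring
    dsimp only
    refine ⟨⟨?_, ?_⟩, i, hi, h4.symm⟩
    · rw [h4, h3]; gcongr; linarith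
    · rw [h4, h3]; gcongr

end AdicSet

open scoped Pointwise in
lemma hausdorffMeasure_real_affine_image {s : ℝ} (hs : 0 ≤ s) {r : ℝ} (hr : 0 < r) (c : ℝ)
    (A : Set ℝ) : (μH[s]).real ((fun z => r * z + c) '' A) = r ^ s * (μH[s]).real A := by
  have h1 : (fun z => r * z + c) '' A = (IsometryEquiv.addRight c) '' (r • A) := by
    rw [← Set.image_smul, Set.image_image]
    simp
  rw [h1, measureReal_def, IsometryEquiv.hausdorffMeasure_image,
    Measure.hausdorffMeasure_smul₀ hs hr.ne', measureReal_def]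
  simp [ENNReal.smul_def, abs_of_pos hr]

/-- The distribution function of `s`-dimensional Hausdorff measure on `A`. -/
noncomputable def hausdorffCDF (s : ℝ) (A : Set ℝ) (x : ℝ) : ℝ :=
  ((μH[s] : Measure ℝ).restrict A).real (Set.Iic x)

section CDF

variable {s : ℝ} {A : Set ℝ}

lemma hausdorffCDF_sub (hA : μH[s] A ≠ ⊤) {x y : ℝ} (hxy : x ≤ y) :
    hausdorffCDF s A y - hausdorffCDF s A x = (μH[s]).real (Set.Ioc x y ∩ A) := by
  have : IsFiniteMeasure ((μH[s] : Measure ℝ).restrict A) :=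
    ⟨by rw [Measure.restrict_apply_univ]; exact hA.lt_top⟩
  rw [hausdorffCDF, hausdorffCDF, ← measureReal_sdiff (Set.Iic_subset_Iic.2 hxy) measurableSet_Iic,
    Set.Iic_sdiff_Iic, measureReal_restrict_apply measurableSet_Ioc]

lemma monotone_hausdorffCDF (hA : μH[s] A ≠ ⊤) : Monotone (hausdorffCDF s A) := by
  intro x y hxy
  have := hausdorffCDF_sub hA hxy
  have h2 := measureReal_nonneg (μ := μH[s]) (s := Set.Ioc x y ∩ A)
  linarith

lemma hausdorff_real_Ioc_inter_eq_Ioo (hs : 0 < s) (x y : ℝ) :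
    (μH[s]).real (Set.Ioc x y ∩ A) = (μH[s]).real (Set.Ioo x y ∩ A) := by
  have := Measure.nullSingletonClass_hausdorff ℝ hs
  refine measureReal_congr ?_
  exact Ioo_ae_eq_Ioc.symm.inter (Filter.EventuallyEq.refl _ _)

variable {n : ℕ} {D : Set (ℕ → ℕ)}

lemma hausdorff_real_Ioo_inter_adicSet (hs : 0 < s) (hn : 2 ≤ n) (hD : ∀ i ∈ D, ∀ k, i k < n) :
    (μH[s]).real (Set.Ioo 0 1 ∩ adicSet n D) = (μH[s]).real (adicSet n D) := by
  have := Measure.nullSingletonClass_hausdorff ℝ hs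
  refine measureReal_congr ?_
  refine (Ioo_ae_eq_Icc.inter (Filter.EventuallyEq.refl _ _)).trans ?_
  rw [Set.inter_eq_right.2 (adicSet_subset_Icc hn hD)]
  exact Filter.EventuallyEq.refl _ _

lemma hausdorffCDF_adic_increment (hs : 0 < s) (hn : 2 ≤ n) (hD : ∀ i ∈ D, ∀ k, i k < n)
    (hfin : μH[s] (adicSet n D) ≠ ⊤) (l : ℕ) (a : ℤ) :
    ((n : ℝ) ^ l) ^ s * (hausdorffCDF s (adicSet n D) ((a + 1) / (n : ℝ) ^ l) -
      hausdorffCDF s (adicSet n D) (a / (n : ℝ) ^ l)) =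
      (μH[s]).real (adicSet n (adicTails n D l a)) := by
  have hP : (0 : ℝ) < (n : ℝ) ^ l := by positivity
  rw [hausdorffCDF_sub hfin (by gcongr; linarith), hausdorff_real_Ioc_inter_eq_Ioo hs,
    Ioo_inter_adicSet hn hD, hausdorffMeasure_real_affine_image hs.le (inv_pos.2 hP),
    hausdorff_real_Ioo_inter_adicSet hs hn (adicTails_lt hD l a), ← mul_assoc,
    Real.inv_rpow hP.le]
  field_simp

end CDF

/-- The digit sequences `i` with `i k ∈ R (j k)` for all `k`, for some `j ∈ J`. -/
def rowSeqs (R : ℕ → Finset ℕ) (J : Set (ℕ → ℕ)) : Set (ℕ → ℕ) :=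
  {i | ∃ j ∈ J, ∀ k, i k ∈ R (j k)}

section RowSeqs

variable {n N : ℕ} {R : ℕ → Finset ℕ} {s : ℝ}

lemma rowSeqs_lt (hR : ∀ j, R j ⊆ Finset.range n) (J : Set (ℕ → ℕ)) :
    ∀ i ∈ rowSeqs R J, ∀ k, i k < n := by
  rintro i ⟨j, -, hij⟩ k
  exact Finset.mem_range.1 (hR _ (hij k))

lemma exists_adicTails_rowSeqs (R : ℕ → Finset ℕ) (J : Set (ℕ → ℕ)) (l : ℕ) (a : ℤ) :
    ∃ J' ⊆ (fun j k => j (k + l)) '' J, adicTails n (rowSeqs R J) l a = rowSeqs R J' := by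
  refine ⟨(fun j k => j (k + l)) '' {j ∈ J | ∃ i, (∀ k, i k ∈ R (j k)) ∧
    (adicLeading n i l : ℤ) = a}, Set.image_mono (Set.sep_subset _ _), ?_⟩
  ext t
  constructor
  · rintro ⟨i, ⟨j, hj, hij⟩, ha, rfl⟩
    exact ⟨_, ⟨j, ⟨hj, i, hij, ha⟩, rfl⟩, fun k => hij _⟩
  · rintro ⟨_, ⟨j, ⟨hj, i, hij, ha⟩, rfl⟩, ht⟩
    refine ⟨fun k => if k < l then i k else t (k - l), ⟨j, hj, fun k => ?_⟩, ?_, ?_⟩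
    · dsimp only
      split_ifs with hk
      · exact hij k
      · have : t (k - l) ∈ R (j (k - l + l)) := ht (k - l)
        rwa [Nat.sub_add_cancel (not_lt.1 hk)] at this
    · rw [← ha, adicLeading_congr (i' := i)]
      intro k hk
      simp [hk]
    · funext k
      simp

/-- The integers formed by the first `l` digits of the sequences in `rowSeqs R {j}`. -/
def rowLeadings (n : ℕ) (R : ℕ → Finset ℕ) (j : ℕ → ℕ) : ℕ → Finset ℕ
  | 0 => {0}
  | l + 1 => (rowLeadings n R j l ×ˢ R (j l)).image fun p => n * p.1 + p.2

lemma card_rowLeadings_le {j : ℕ → ℕ} (hN : ∀ k, (R (j k)).card ≤ N) (l : ℕ) :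
    (rowLeadings n R j l).card ≤ N ^ l := by
  induction l with
  | zero => simp [rowLeadings]
  | succ l ih =>
    rw [rowLeadings, pow_succ]
    refine Finset.card_image_le.trans ?_
    rw [Finset.card_product]
    exact Nat.mul_le_mul ih (hN l)

lemma adicLeading_mem_rowLeadings {i j : ℕ → ℕ} (hij : ∀ k, i k ∈ R (j k)) (l : ℕ) :
    adicLeading n i l ∈ rowLeadings n R j l := by
  induction l with
  | zero => simp [rowLeadings, adicLeading]
  | succ l ih =>
    rw [rowLeadings, adicLeading, Finset.mem_image]
    exact ⟨(adicLeading n i l, i l), Finset.mem_product.2 ⟨ih, hij l⟩, rfl⟩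

lemma hausdorffMeasure_rowSeqs_le_one (hn : 2 ≤ n) (hNs : (n : ℝ) ^ s = N)
    (hR : ∀ j, R j ⊆ Finset.range n) {j : ℕ → ℕ} (hN : ∀ k, (R (j k)).card ≤ N) :
    μH[s] (adicSet n (rowSeqs R {j})) ≤ 1 := by
  have hn0 : (0 : ℝ) < n := by positivity
  have hn1 : (1 : ℝ) < n := by exact_mod_cast hn
  have hdiam : ∀ (l : ℕ) (a : ℕ),
      Metric.ediam (Set.Icc ((a : ℝ) / (n : ℝ) ^ l) ((a + 1) / (n : ℝ) ^ l)) =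
        ENNReal.ofReal (((n : ℝ) ^ l)⁻¹) := by
    intro l a
    rw [Real.ediam_Icc]
    congr 1
    ring
  have hlim : Filter.Tendsto (fun l : ℕ => ENNReal.ofReal (((n : ℝ) ^ l)⁻¹)) Filter.atTop
      (nhds 0) := by
    rw [← ENNReal.ofReal_zero]
    refine ENNReal.tendsto_ofReal ?_
    simp_rw [← inv_pow]
    exact tendsto_pow_atTop_nhds_zero_of_lt_one (by positivity) (inv_lt_one_of_one_lt₀ hn1)
  refine (Measure.hausdorffMeasure_le_liminf_sum (ι := fun l => rowLeadings n R j l) s _ _ hlim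
    (fun l a => Set.Icc ((a : ℝ) / (n : ℝ) ^ l) (((a : ℕ) + 1) / (n : ℝ) ^ l))
    (Filter.Eventually.of_forall fun l a => (hdiam l a).le)
    (Filter.Eventually.of_forall fun l => ?_)).trans ?_
  · rintro _ ⟨i, hi, rfl⟩
    have hlt := rowSeqs_lt hR _ i hi
    obtain ⟨_, rfl, hij⟩ := hi
    refine Set.mem_iUnion.2 ⟨⟨_, adicLeading_mem_rowLeadings hij l⟩, ?_⟩
    have h1 := adicValue_nonneg (n := n) (i := fun k => i (k + l))
    have h2 := adicValue_le_one hn (i := fun k => i (k + l)) (fun k => hlt _)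
    rw [adicValue_eq_add_div hn hlt l]
    constructor
    · gcongr; linarith
    · gcongr
  · have hle : ∀ l : ℕ, ∑ a : rowLeadings n R j l,
        Metric.ediam (Set.Icc (((a : ℕ) : ℝ) / (n : ℝ) ^ l) (((a : ℕ) + 1) / (n : ℝ) ^ l)) ^ s ≤
          1 := by
      intro l
      simp_rw [hdiam]
      rw [Finset.sum_const, Finset.card_univ, Fintype.card_coe, nsmul_eq_mul,
        ENNReal.ofReal_rpow_of_pos (by positivity), ← ENNReal.ofReal_natCast,
        ← ENNReal.ofReal_mul (by positivity), ENNReal.ofReal_le_one, Real.inv_rpow (by positivity),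
        ← Real.rpow_natCast, ← Real.rpow_mul hn0.le, mul_comm (l : ℝ), Real.rpow_mul hn0.le, hNs,
        Real.rpow_natCast]
      have h0 : (0 : ℝ) < N := by rw [← hNs]; positivity
      rw [← div_eq_mul_inv, div_le_one (by positivity)]
      exact_mod_cast card_rowLeadings_le hN l
    refine (Filter.liminf_le_liminf (Filter.Eventually.of_forall hle)).trans_eq ?_
    exact Filter.liminf_const _

lemma hausdorff_real_rowSeqs_step (hn : 2 ≤ n) (hs : 0 < s)
    (hR : ∀ j, R j ⊆ Finset.range n) {j : ℕ → ℕ} (hfin : μH[s] (adicSet n (rowSeqs R {j})) ≠ ⊤) :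
    (n : ℝ) ^ s * (μH[s]).real (adicSet n (rowSeqs R {j})) =
      (R (j 0)).card * (μH[s]).real (adicSet n (rowSeqs R {fun k => j (k + 1)})) := by
  have hn0 : (0 : ℝ) < n := by positivity
  have hD := rowSeqs_lt (n := n) hR {j}
  set G := hausdorffCDF s (adicSet n (rowSeqs R {j})) with hG
  have htot : (μH[s]).real (adicSet n (rowSeqs R {j})) = G 1 - G 0 := by
    rw [hG, hausdorffCDF_sub hfin zero_le_one, hausdorff_real_Ioc_inter_eq_Ioo hs,
      hausdorff_real_Ioo_inter_adicSet hs hn hD]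
  have htel := Finset.sum_range_sub (fun a : ℕ => G (a / (n : ℝ))) n
  simp only [Nat.cast_zero, zero_div, div_self hn0.ne'] at htel
  rw [htot, ← htel, Finset.mul_sum]
  have hterm : ∀ a : ℕ, (n : ℝ) ^ s * (G (((a + 1 : ℕ) : ℝ) / n) - G (a / n)) =
      if a ∈ R (j 0) then (μH[s]).real (adicSet n (rowSeqs R {fun k => j (k + 1)})) else 0 := by
    intro a
    have h1 := hausdorffCDF_adic_increment hs hn hD hfin 1 a
    simp only [pow_one, Int.cast_natCast] at h1
    push_cast
    rw [h1]
    split_ifs with ha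
    · congr 2
      ext t
      constructor
      · rintro ⟨i, ⟨_, rfl, hij⟩, -, rfl⟩
        exact ⟨_, rfl, fun k => hij _⟩
      · rintro ⟨_, rfl, ht⟩
        refine ⟨fun k => if k = 0 then a else t (k - 1), ⟨j, rfl, fun k => ?_⟩, ?_, ?_⟩
        · rcases k with _ | k
          · simpa using ha
          · simpa using ht k
        · simp [adicLeading]
        · funext k
          simp
    · have : adicTails n (rowSeqs R {j}) 1 a = ∅ := by
        refine Set.eq_empty_iff_forall_notMem.2 ?_
        rintro _ ⟨i, ⟨_, rfl, hij⟩, h2, -⟩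
        simp only [adicLeading, mul_zero, zero_add, Nat.cast_inj] at h2
        exact ha (h2 ▸ hij 0)
      rw [this]
      simp [adicSet]
  rw [Finset.sum_congr rfl fun a _ => hterm a, ← Finset.sum_filter, Finset.sum_const, nsmul_eq_mul,
    Finset.filter_mem_eq_inter, Finset.inter_eq_right.2 (hR _)]

end RowSeqs

/-- A bounded nonnegative sequence with `N * u l = c l * u (l + 1)` for integers `c l ≤ N` takes
finitely many values. -/
lemma finite_range_of_integer_ratio {N : ℕ} {u : ℕ → ℝ} {C : ℝ} (c : ℕ → ℕ)
    (hN : 0 < N) (hc : ∀ l, c l ≤ N) (hu0 : ∀ l, 0 ≤ u l) (huC : ∀ l, u l ≤ C)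
    (hu : ∀ l, (N : ℝ) * u l = c l * u (l + 1)) : (Set.range u).Finite := by
  have hN' : (0 : ℝ) < N := by exact_mod_cast hN
  have hmono : Monotone u := by
    refine monotone_nat_of_le_succ fun l => le_of_mul_le_mul_left ?_ hN'
    rw [hu]
    exact mul_le_mul_of_nonneg_right (by exact_mod_cast hc l) (hu0 _)
  have hbdd : BddAbove (Set.range u) := ⟨C, by rintro _ ⟨l, rfl⟩; exact huC l⟩
  have hjump : ∀ l, u l = u (l + 1) ∨ u (l + 1) / N ≤ u (l + 1) - u l := by
    intro l
    rcases (hc l).eq_or_lt with h | h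
    · left
      have := hu l
      rw [h] at this
      exact mul_left_cancel₀ hN'.ne' this
    · right
      have h1 : (c l : ℝ) + 1 ≤ N := by exact_mod_cast h
      have h2 := mul_le_mul_of_nonneg_right h1 (hu0 (l + 1))
      rw [div_le_iff₀ hN']
      have := hu l
      linarith
  by_cases hz : ∀ l, u l = 0
  · exact (Set.finite_singleton (0 : ℝ)).subset (by rintro _ ⟨l, rfl⟩; exact hz l)
  push Not at hz
  obtain ⟨l₁, hl₁⟩ := hz
  have hpos : 0 < u l₁ := lt_of_le_of_ne (hu0 _) hl₁.symm
  obtain ⟨_, ⟨l₂, rfl⟩, hl₂⟩ := exists_lt_of_lt_csSup (Set.range_nonempty u)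
    (show sSup (Set.range u) - u l₁ / N < sSup (Set.range u) by
      have : 0 < u l₁ / N := by positivity
      linarith)
  have hconst : ∀ l ≥ max l₁ l₂, u l = u (max l₁ l₂) := by
    intro l hl
    induction l, hl using Nat.le_induction with
    | base => rfl
    | succ l hl ih =>
      rw [← ih]
      rcases hjump l with h | h
      · exact h.symm
      · exfalso
        have h1 := le_csSup hbdd ⟨l + 1, rfl⟩
        have h2 := hmono ((le_max_right l₁ l₂).trans hl)
        have h3 := hmono (((le_max_left l₁ l₂).trans hl).trans (Nat.le_succ l))
        have h4 : u l₁ / N ≤ u (l + 1) / N := by gcongr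
        linarith
  refine ((Set.finite_Iic (max l₁ l₂)).image u).subset ?_
  rintro _ ⟨l, rfl⟩
  rcases le_total l (max l₁ l₂) with h | h
  · exact ⟨l, h, rfl⟩
  · exact ⟨_, Set.mem_Iic.2 le_rfl, (hconst l h).symm⟩

/-- The Hausdorff distribution function of the reals whose base-`n` digits follow rows coded by
the base-`m` expansions of `y` has finitely many rescaled increments. -/
lemma finiteAdicIncrements_rowSeqs {n m N : ℕ} {R : ℕ → Finset ℕ} {s : ℝ} (hn : 2 ≤ n)
    (hm : 2 ≤ m) (hs : 0 < s) (hNs : (n : ℝ) ^ s = N) (hR : ∀ j, R j ⊆ Finset.range n)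
    (hN : ∀ j < m, (R j).card ≤ N) (y : ℝ)
    (hfin : μH[s] (adicSet n (rowSeqs R {j | (∀ k, j k < m) ∧ adicValue m j = y})) ≠ ⊤) :
    ∃ (l₀ : ℕ) (V : Set ℝ), FiniteAdicIncrements n l₀ s V
      (hausdorffCDF s (adicSet n (rowSeqs R {j | (∀ k, j k < m) ∧ adicValue m j = y}))) := by
  set Y := {j : ℕ → ℕ | (∀ k, j k < m) ∧ adicValue m j = y} with hY
  set H : Set (ℕ → ℕ) → ℝ := fun J => (μH[s]).real (adicSet n (rowSeqs R J)) with hH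
  suffices h : ∃ (l₀ : ℕ) (V : Set ℝ), V.Finite ∧
      ∀ l ≥ l₀, ∀ J ⊆ (fun (j : ℕ → ℕ) k => j (k + l)) '' Y, H J ∈ V by
    obtain ⟨l₀, V, hV, h⟩ := h
    refine ⟨l₀, V, hV, fun l hl a => ?_⟩
    obtain ⟨J, hJ, hJeq⟩ := exists_adicTails_rowSeqs (n := n) R Y l a
    rw [hausdorffCDF_adic_increment hs hn (rowSeqs_lt hR _) hfin, hJeq]
    exact h l hl J hJ
  rcases adicValue_fiber_dichotomy hm y with hsub | ⟨l₀, hl₀⟩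
  · rcases hsub.eq_empty_or_singleton with hE | ⟨j, hj⟩
    · refine ⟨0, {H ∅}, Set.finite_singleton _, fun l _ J hJ => ?_⟩
      rw [hY, hE, Set.image_empty, Set.subset_empty_iff] at hJ
      rw [hJ]
      rfl
    · have hjm : ∀ k, j k < m := by
        have : j ∈ Y := by rw [hY, hj]; rfl
        exact this.1
      have hle : ∀ l, μH[s] (adicSet n (rowSeqs R {fun k => j (k + l)})) ≤ 1 := fun l =>
        hausdorffMeasure_rowSeqs_le_one hn hNs hR fun k => hN _ (hjm _)
      have hN0 : 0 < N := by
        have : (0 : ℝ) < N := by rw [← hNs]; positivity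
        exact_mod_cast this
      refine ⟨0, insert (H ∅) (Set.range fun l => H {fun k => j (k + l)}),
        Set.Finite.insert _ ?_, fun l _ J hJ => ?_⟩
      · refine finite_range_of_integer_ratio (C := 1) (fun l => (R (j l)).card) hN0
          (fun l => hN _ (hjm _)) (fun l => measureReal_nonneg) (fun l => ?_) (fun l => ?_)
        · exact ENNReal.toReal_le_of_le_ofReal zero_le_one (by simpa using hle l)
        · have := hausdorff_real_rowSeqs_step hn hs hR
            (ne_top_of_le_ne_top ENNReal.one_ne_top (hle l))
          rw [hNs] at this
          simpa only [zero_add, add_right_comm _ 1 l, ← add_assoc] using this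
      · rw [hY, hj, Set.image_singleton, Set.subset_singleton_iff_eq] at hJ
        rcases hJ with rfl | rfl
        · exact Set.mem_insert _ _
        · exact Set.mem_insert_of_mem _ ⟨l, rfl⟩
  · refine ⟨l₀, H '' 𝒫 {(fun _ => 0), (fun _ => m - 1)},
      (Set.Finite.finite_subsets (Set.toFinite _)).image _, fun l hl J hJ => ?_⟩
    refine ⟨J, hJ.trans ?_, rfl⟩
    rintro _ ⟨j, ⟨hjm, hjy⟩, rfl⟩
    exact hl₀ l hl j hjm hjy

lemma mem_rowDigits {Λ : Finset (ℕ × ℕ)} {i j : ℕ} : i ∈ rowDigits Λ j ↔ (i, j) ∈ Λ := by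
  simp [rowDigits]

lemma horizSlice_BMCarpet {n m : ℕ} {Λ : Finset (ℕ × ℕ)}
    (hΛ : Λ ⊆ Finset.range n ×ˢ Finset.range m) (y : ℝ) :
    horizSlice (BMCarpet n m Λ) y =
      adicSet n (rowSeqs (rowDigits Λ) {j | (∀ k, j k < m) ∧ adicValue m j = y}) := by
  ext x
  constructor
  · rintro ⟨d, hd, hx, hy⟩
    refine ⟨fun k => (d k).1, ⟨fun k => (d k).2, ⟨fun k => ?_, hy.symm⟩, fun k => ?_⟩, hx.symm⟩
    · exact Finset.mem_range.1 (Finset.mem_product.1 (hΛ (hd k))).2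
    · exact mem_rowDigits.2 (hd k)
  · rintro ⟨i, ⟨j, ⟨-, hy⟩, hij⟩, hx⟩
    exact ⟨fun k => (i k, j k), fun k => mem_rowDigits.1 (hij k), hx.symm, hy.symm⟩

/-- A similitude of the real line is an affine map. -/
lemma exists_eq_add_mul_of_similitude {h : ℝ → ℝ} {ρ : ℝ} (hρ : ρ ≠ 0)
    (hsim : ∀ x x' : ℝ, |h x - h x'| = ρ * |x - x'|) :
    ∃ τ, τ ^ 2 = ρ ^ 2 ∧ ∀ x, h x = h 0 + τ * x := by
  have hsq : ∀ x x', (h x - h x') ^ 2 = ρ ^ 2 * (x - x') ^ 2 := fun x x' => by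
    rw [← sq_abs, hsim, mul_pow, sq_abs]
  have hτ : (h 1 - h 0) ^ 2 = ρ ^ 2 := by simpa using hsq 1 0
  have hτ0 : h 1 - h 0 ≠ 0 := fun h0 => hρ (by simpa [h0] using hτ.symm)
  refine ⟨h 1 - h 0, hτ, fun x => ?_⟩
  have h1 := hsq x 0
  have h2 := hsq x 1
  refine mul_left_cancel₀ hτ0 ?_
  linear_combination (1 / 2) * h1 - (1 / 2) * h2 + (1 / 2 - x) * hτ

theorem slice_embedding_log_commensurable
    (n m : ℕ) (Λ : Finset (ℕ × ℕ))
    (hm : 2 ≤ m) (hnm : m < n)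
    (hΛsub : Λ ⊆ Finset.range n ×ˢ Finset.range m)
    (hΛ1 : 1 < Λ.card) (hΛ2 : Λ.card < m * n)
    (hN2 : 2 ≤ maxRowCard m Λ) (hNn : maxRowCard m Λ ≤ n - 1)
    (y : ℝ) (hy : y ∈ Prod.snd '' BMCarpet n m Λ)
    (α : ℝ) (hα : α = Real.log (maxRowCard m Λ) / Real.log n)
    (hpos : 0 < μH[α] (horizSlice (BMCarpet n m Λ) y))
    (hfin : μH[α] (horizSlice (BMCarpet n m Λ) y) < ⊤)
    (h : ℝ → ℝ) (ρ : ℝ) (hρ0 : 0 < ρ) (hρ1 : ρ < 1)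
    (hsim : ∀ x x' : ℝ, |h x - h x'| = ρ * |x - x'|)
    (hsub : h '' horizSlice (BMCarpet n m Λ) y ⊆ horizSlice (BMCarpet n m Λ) y) :
    ∃ q : ℚ, Real.log ρ / Real.log n = (q : ℝ) := by
  have hn : 2 ≤ n := by omega
  have hn1 : (1 : ℝ) < n := by exact_mod_cast hn
  have hlogn : 0 < Real.log n := Real.log_pos hn1
  have hNpos : (1 : ℝ) < maxRowCard m Λ := by exact_mod_cast hN2
  have hα0 : 0 < α := by rw [hα]; exact div_pos (Real.log_pos hNpos) hlogn
  have hα1 : α < 1 := by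
    rw [hα, div_lt_one hlogn]
    refine Real.log_lt_log (by positivity) ?_
    have : maxRowCard m Λ < n := by omega
    exact_mod_cast this
  have hNs : (n : ℝ) ^ α = maxRowCard m Λ := by
    rw [Real.rpow_def_of_pos (by positivity), hα, mul_div_cancel₀ _ hlogn.ne',
      Real.exp_log (by positivity)]
  have hR : ∀ j, rowDigits Λ j ⊆ Finset.range n := fun j i hi =>
    (Finset.mem_product.1 (hΛsub (mem_rowDigits.1 hi))).1
  have hNle : ∀ j < m, (rowDigits Λ j).card ≤ maxRowCard m Λ := fun j hj =>
    Finset.le_sup (f := fun j => (rowDigits Λ j).card) (Finset.mem_range.2 hj)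
  have hslice := horizSlice_BMCarpet hΛsub y
  obtain ⟨S, hS⟩ : ∃ S, S = horizSlice (BMCarpet n m Λ) y := ⟨_, rfl⟩
  rw [← hS] at hslice hpos hfin hsub
  obtain ⟨l₀, V, hV⟩ := finiteAdicIncrements_rowSeqs hn hm hα0 hNs hR hNle y
    (by rw [← hslice]; exact hfin.ne)
  rw [← hslice] at hV
  have hSIcc : S ⊆ Set.Icc 0 1 := hslice ▸ adicSet_subset_Icc hn (rowSeqs_lt hR _)
  have hne : ∃ x x', hausdorffCDF α S x < hausdorffCDF α S x' := by
    refine ⟨-1, 1, ?_⟩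
    rw [← sub_pos, hausdorffCDF_sub hfin.ne (by norm_num), Set.inter_eq_right.2]
    · exact ENNReal.toReal_pos hpos.ne' hfin.ne
    · exact fun x hx => ⟨by linarith [(hSIcc hx).1], (hSIcc hx).2⟩
  obtain ⟨τ, hτ, haff⟩ := exists_eq_add_mul_of_similitude hρ0.ne' hsim
  have hiter : ∀ k : ℕ, ∃ c, ∀ x ∈ S, (ρ ^ 2) ^ k * x + c ∈ S := by
    intro k
    induction k with
    | zero => exact ⟨0, by simp⟩
    | succ k ih =>
      obtain ⟨c, hc⟩ := ih
      refine ⟨h (h c), fun x hx => ?_⟩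
      have h1 := hsub ⟨_, hsub ⟨_, hc x hx, rfl⟩, rfl⟩
      convert h1 using 1
      rw [haff (h c), haff c, haff (h _), haff (_ + c), ← hτ]
      ring
  have hemb : ∀ k : ℕ, ∃ c, ∀ x x', x ≤ x' →
      ((ρ ^ 2) ^ k) ^ α * (hausdorffCDF α S x' - hausdorffCDF α S x) ≤
        hausdorffCDF α S ((ρ ^ 2) ^ k * x' + c) - hausdorffCDF α S ((ρ ^ 2) ^ k * x + c) := by
    intro k
    obtain ⟨c, hc⟩ := hiter k
    have hr : 0 < (ρ ^ 2) ^ k := by positivity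
    refine ⟨c, fun x x' hxx' => ?_⟩
    rw [hausdorffCDF_sub hfin.ne hxx', hausdorffCDF_sub hfin.ne (by gcongr),
      ← hausdorffMeasure_real_affine_image hα0.le hr c]
    refine measureReal_mono ?_ (measure_ne_top_of_subset Set.inter_subset_right hfin.ne)
    rintro _ ⟨z, ⟨⟨hz1, hz2⟩, hzS⟩, rfl⟩
    exact ⟨⟨by dsimp only; gcongr, by dsimp only; gcongr⟩, hc z hzS⟩
  obtain ⟨q, hq⟩ := hV.log_div_log_rational hn hα0 hα1 (monotone_hausdorffCDF hfin.ne) hne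
    (show 0 < ρ ^ 2 by positivity) (pow_lt_one₀ hρ0.le hρ1 two_ne_zero) hemb
  refine ⟨q / 2, ?_⟩
  rw [Real.log_pow] at hq
  push_cast at hq ⊢
  rw [← hq]
  ring
end

section
/- Let K = K(n,m,Λ) be a Bedford–McMullen carpet (n > m ≥ 2) with log n / log m rational, not contained in any affine line of ℝ². Let f be a similitude on ℝ² with similarity ratio λ ∈ (0,1) such that f(K) ⊆ K. Then there exist a similitude g on ℝ² with positive similarity ratio and a compact set C ⊆ ℝ with Hausdorff dimension dim_H C ≤ log N / log n such that g(K) ⊆ C × ℝ. Moreover, if f is oblique, then g can be chosen to be oblique. -/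
open scoped BigOperators

theorem IsSimilitude.sq_dist {h : ℝ × ℝ → ℝ × ℝ} {r : ℝ} (hh : IsSimilitude h r) (x y : ℝ × ℝ) :
    ((h x).1 - (h y).1) ^ 2 + ((h x).2 - (h y).2) ^ 2
      = r ^ 2 * ((x.1 - y.1) ^ 2 + (x.2 - y.2) ^ 2) := by
  have h1 := congrArg (· ^ 2) (hh x y)
  simp only [mul_pow] at h1
  rwa [Real.sq_sqrt (by positivity), Real.sq_sqrt (by positivity)] at h1

theorem IsSimilitude.comp {g h : ℝ × ℝ → ℝ × ℝ} {r t : ℝ} (hg : IsSimilitude g r)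
    (hh : IsSimilitude h t) : IsSimilitude (g ∘ h) (r * t) := fun x y => by
  simp only [Function.comp_apply]
  rw [hg, hh, mul_assoc]

theorem IsSimilitude.iterate {h : ℝ × ℝ → ℝ × ℝ} {r : ℝ} (hh : IsSimilitude h r) (k : ℕ) :
    IsSimilitude h^[k] (r ^ k) := by
  induction k with
  | zero => intro x y; simp
  | succ k ih => rw [Function.iterate_succ, pow_succ]; exact ih.comp hh

/-- The first coordinate of a similitude is an affine form whose gradient has length the ratio. -/
theorem IsSimilitude.exists_fst_eq {h : ℝ × ℝ → ℝ × ℝ} {r : ℝ} (hr : 0 < r)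
    (hh : IsSimilitude h r) :
    ∃ A B E : ℝ, A ^ 2 + B ^ 2 = r ^ 2 ∧ ∀ p, (h p).1 = A * p.1 + B * p.2 + E := by
  have huv := hh.sq_dist (1, 0) (0, 1)
  have hu := hh.sq_dist (1, 0) (0, 0)
  have hv := hh.sq_dist (0, 1) (0, 0)
  refine ⟨(h (1, 0)).1 - (h (0, 0)).1, (h (0, 1)).1 - (h (0, 0)).1, (h (0, 0)).1, ?_, ?_⟩
  · obtain ⟨u1, hu1⟩ : ∃ a, a = (h (1, 0)).1 - (h (0, 0)).1 := ⟨_, rfl⟩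
    obtain ⟨u2, hu2⟩ : ∃ a, a = (h (1, 0)).2 - (h (0, 0)).2 := ⟨_, rfl⟩
    obtain ⟨v1, hv1⟩ : ∃ a, a = (h (0, 1)).1 - (h (0, 0)).1 := ⟨_, rfl⟩
    obtain ⟨v2, hv2⟩ : ∃ a, a = (h (0, 1)).2 - (h (0, 0)).2 := ⟨_, rfl⟩
    rw [← hu1, ← hv1]
    rw [← hu1, ← hu2] at hu
    rw [← hv1, ← hv2] at hv
    have e1 : (h (1, 0)).1 - (h (0, 1)).1 = u1 - v1 := by rw [hu1, hv1]; ring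
    have e2 : (h (1, 0)).2 - (h (0, 1)).2 = u2 - v2 := by rw [hu2, hv2]; ring
    rw [e1, e2] at huv
    norm_num at hu hv huv
    have h0 : u1 * v1 = - (u2 * v2) := by linarith
    have h1 : (u1 * v1) ^ 2 = (u2 * v2) ^ 2 := by rw [h0]; ring
    have h2 : u2 ^ 2 = r ^ 2 - u1 ^ 2 := by linarith
    have h3 : v2 ^ 2 = r ^ 2 - v1 ^ 2 := by linarith
    rw [mul_pow, mul_pow, h2, h3] at h1
    have h4 : r ^ 2 * (u1 ^ 2 + v1 ^ 2) = r ^ 2 * r ^ 2 := by linarith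
    exact mul_left_cancel₀ (by positivity) h4
  · rintro ⟨x, y⟩
    have hp0 := hh.sq_dist (x, y) (0, 0)
    have hpu := hh.sq_dist (x, y) (1, 0)
    have hpv := hh.sq_dist (x, y) (0, 1)
    generalize h (x, y) = P at *
    generalize h (1, 0) = U at *
    generalize h (0, 1) = V at *
    generalize h (0, 0) = O at *
    obtain ⟨P1, P2⟩ := P
    obtain ⟨U1, U2⟩ := U
    obtain ⟨V1, V2⟩ := V
    obtain ⟨O1, O2⟩ := O
    simp only at *
    have key : (P1 - O1 - x * (U1 - O1) - y * (V1 - O1)) ^ 2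
        + (P2 - O2 - x * (U2 - O2) - y * (V2 - O2)) ^ 2 = 0 := by
      linear_combination (1 - x - y) * hp0 + x * hpu + y * hpv
        + (x ^ 2 - x + x * y) * hu + (y ^ 2 - y + x * y) * hv - x * y * huv
    have := (add_eq_zero_iff_of_nonneg (sq_nonneg _) (sq_nonneg _)).1 key
    have := pow_eq_zero_iff (two_ne_zero) |>.1 this.1
    linarith

/-- The first `t` digits of `d` read as a number in base `b`. -/
def digitPrefix (b : ℕ) (d : ℕ → ℕ) : ℕ → ℕ
  | 0 => 0
  | t + 1 => b * digitPrefix b d t + d t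

section digits

variable {b : ℕ} {d : ℕ → ℕ}

theorem hasSum_pred_div_pow (hb : 2 ≤ b) :
    HasSum (fun k : ℕ => ((b : ℝ) - 1) / (b : ℝ) ^ (k + 1)) 1 := by
  have hb' : (2 : ℝ) ≤ b := by exact_mod_cast hb
  have h := (hasSum_geometric_of_lt_one (r := (b : ℝ)⁻¹) (by positivity)
    (inv_lt_one_of_one_lt₀ (by linarith))).mul_left (((b : ℝ) - 1) / b)
  have h1 : ((b : ℝ) - 1) / b * (1 - (b : ℝ)⁻¹)⁻¹ = 1 := by
    have : (b : ℝ) - 1 ≠ 0 := by linarith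
    field_simp
  rw [h1] at h
  refine h.congr_fun fun k => ?_
  rw [inv_pow, pow_succ]
  field_simp

theorem digit_div_pow_le (hd : ∀ k, d k < b) (k : ℕ) :
    (d k : ℝ) / (b : ℝ) ^ (k + 1) ≤ ((b : ℝ) - 1) / (b : ℝ) ^ (k + 1) := by
  gcongr
  have : (d k : ℝ) + 1 ≤ b := by exact_mod_cast hd k
  linarith

theorem summable_digits (hb : 2 ≤ b) (hd : ∀ k, d k < b) :
    Summable fun k : ℕ => (d k : ℝ) / (b : ℝ) ^ (k + 1) :=
  (hasSum_pred_div_pow hb).summable.of_nonneg_of_le (fun _ => by positivity) (digit_div_pow_le hd)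

theorem tsum_digits_nonneg : 0 ≤ ∑' k : ℕ, (d k : ℝ) / (b : ℝ) ^ (k + 1) :=
  tsum_nonneg fun _ => by positivity

theorem tsum_digits_le_one (hb : 2 ≤ b) (hd : ∀ k, d k < b) :
    ∑' k : ℕ, (d k : ℝ) / (b : ℝ) ^ (k + 1) ≤ 1 :=
  (hasSum_pred_div_pow hb).tsum_eq ▸ (summable_digits hb hd).tsum_le_tsum (digit_div_pow_le hd)
    (hasSum_pred_div_pow hb).summable

theorem mul_tsum_digits (hb : 2 ≤ b) (hd : ∀ k, d k < b) :
    (b : ℝ) * ∑' k : ℕ, (d k : ℝ) / (b : ℝ) ^ (k + 1)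
      = d 0 + ∑' k : ℕ, (d (k + 1) : ℝ) / (b : ℝ) ^ (k + 1) := by
  have hb' : (b : ℝ) ≠ 0 := by positivity
  rw [(summable_digits hb hd).tsum_eq_zero_add, mul_add, ← tsum_mul_left]
  congr 1
  · rw [zero_add, pow_one, mul_div_cancel₀ _ hb']
  · congr 1
    ext k
    rw [pow_succ _ (k + 1)]
    field_simp

theorem pow_mul_tsum_digits (hb : 2 ≤ b) (hd : ∀ k, d k < b) (t : ℕ) :
    (b : ℝ) ^ t * ∑' k : ℕ, (d k : ℝ) / (b : ℝ) ^ (k + 1)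
      = digitPrefix b d t + ∑' k : ℕ, (d (k + t) : ℝ) / (b : ℝ) ^ (k + 1) := by
  induction t with
  | zero => simp [digitPrefix]
  | succ t ih =>
    have h := mul_tsum_digits (d := fun k => d (k + t)) hb fun k => hd _
    rw [pow_succ', mul_assoc, ih, mul_add, h]
    simp only [digitPrefix, zero_add, add_right_comm _ 1 t, add_assoc _ t 1]
    push_cast
    ring

theorem digitPrefix_le (hb : 2 ≤ b) (hd : ∀ k, d k < b) (t : ℕ) :
    (digitPrefix b d t : ℝ) ≤ (b : ℝ) ^ t * ∑' k : ℕ, (d k : ℝ) / (b : ℝ) ^ (k + 1) := by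
  rw [pow_mul_tsum_digits hb hd]
  exact le_add_of_nonneg_right (tsum_digits_nonneg (d := fun k => d (k + t)))

theorem le_digitPrefix_add_one (hb : 2 ≤ b) (hd : ∀ k, d k < b) (t : ℕ) :
    (b : ℝ) ^ t * ∑' k : ℕ, (d k : ℝ) / (b : ℝ) ^ (k + 1) ≤ digitPrefix b d t + 1 := by
  rw [pow_mul_tsum_digits hb hd]
  exact add_le_add_right (tsum_digits_le_one (d := fun k => d (k + t)) hb fun k => hd _) _

/-- Prefixes of two expansions of nearby points are close to each other. -/
theorem digitPrefix_mem_Icc {d' : ℕ → ℕ} (hb : 2 ≤ b) (hd : ∀ k, d k < b) (hd' : ∀ k, d' k < b)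
    {t : ℕ} (h : (b : ℝ) ^ t * |∑' k : ℕ, (d k : ℝ) / (b : ℝ) ^ (k + 1)
      - ∑' k : ℕ, (d' k : ℝ) / (b : ℝ) ^ (k + 1)| ≤ 2) :
    digitPrefix b d t ∈ Finset.Icc (digitPrefix b d' t - 3) (digitPrefix b d' t + 3) := by
  have h1 := digitPrefix_le hb hd t
  have h2 := le_digitPrefix_add_one hb hd t
  have h3 := digitPrefix_le hb hd' t
  have h4 := le_digitPrefix_add_one hb hd' t
  rw [← abs_of_nonneg (by positivity : (0 : ℝ) ≤ (b : ℝ) ^ t), ← abs_mul, abs_le, mul_sub] at h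
  have h5 : (digitPrefix b d t : ℝ) ≤ (digitPrefix b d' t + 3 : ℕ) := by push_cast; linarith
  have h6 : (digitPrefix b d' t : ℝ) ≤ (digitPrefix b d t + 3 : ℕ) := by push_cast; linarith
  have h7 := Nat.cast_le.1 h5
  have h8 := Nat.cast_le.1 h6
  rw [Finset.mem_Icc]
  omega

end digits

/-- The base-`n` values of the length-`L` digit blocks all of whose digits are compatible with the
last `L` base-`m` digits of `J`. -/
def rowBlocks (n m : ℕ) (Λ : Finset (ℕ × ℕ)) : ℕ → ℕ → Finset ℕ
  | 0, _ => {0}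
  | L + 1, J => (rowBlocks n m Λ L (J / m) ×ˢ rowDigits Λ (J % m)).image fun q => n * q.1 + q.2

theorem card_rowBlocks_le {n m : ℕ} (hm : 0 < m) (Λ : Finset (ℕ × ℕ)) (L J : ℕ) :
    (rowBlocks n m Λ L J).card ≤ maxRowCard m Λ ^ L := by
  induction L generalizing J with
  | zero => simp [rowBlocks]
  | succ L ih =>
    refine Finset.card_image_le.trans ?_
    rw [Finset.card_product, pow_succ]
    exact Nat.mul_le_mul (ih _) (Finset.le_sup (f := fun j => (rowDigits Λ j).card)
      (Finset.mem_range.2 (Nat.mod_lt _ hm)))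

theorem exists_digitPrefix_add_eq {n m : ℕ} {Λ : Finset (ℕ × ℕ)}
    (hΛ : Λ ⊆ Finset.range n ×ˢ Finset.range m) {d : ℕ → ℕ × ℕ} (hd : ∀ k, d k ∈ Λ) (s L : ℕ) :
    ∃ a ∈ rowBlocks n m Λ L (digitPrefix m (fun k => (d k).2) (s + L)),
      digitPrefix n (fun k => (d k).1) (s + L)
        = n ^ L * digitPrefix n (fun k => (d k).1) s + a := by
  induction L with
  | zero => exact ⟨0, by simp [rowBlocks], by simp⟩
  | succ L ih =>
    obtain ⟨a, ha, e⟩ := ih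
    have hlt : (d (s + L)).2 < m :=
      Finset.mem_range.1 (Finset.mem_product.1 (hΛ (hd (s + L)))).2
    refine ⟨n * a + (d (s + L)).1, ?_, ?_⟩
    · rw [← add_assoc]
      simp only [rowBlocks, digitPrefix, Finset.mem_image, Finset.mem_product]
      refine ⟨(a, (d (s + L)).1), ⟨?_, ?_⟩, rfl⟩
      · rwa [Nat.mul_add_div (by omega), Nat.div_eq_of_lt hlt, add_zero]
      · rw [Nat.mul_add_mod, Nat.mod_eq_of_lt hlt]
        exact Finset.mem_image.2 ⟨d (s + L), Finset.mem_filter.2 ⟨hd _, rfl⟩, rfl⟩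
    · rw [← add_assoc]
      simp only [digitPrefix]
      rw [e]
      ring

/-- A set of reals covered, for every `L`, by `O(N ^ L)` intervals of length `O(n ^ (-L))` has a
closure of Hausdorff dimension at most `log N / log n`. -/
theorem dimH_closure_le_of_covers {S : Set ℝ} {n N c : ℕ} {r : ℝ} (hn : 2 ≤ n) (hN : 1 ≤ N)
    (hr : 0 ≤ r)
    (h : ∀ L : ℕ, ∃ T : Finset ℝ, T.card ≤ c * N ^ L ∧
      ∀ x ∈ S, ∃ t ∈ T, |x - t| ≤ r / (n : ℝ) ^ L) :
    dimH (closure S) ≤ ENNReal.ofReal (Real.log N / Real.log n) := by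
  choose T hcard hT using h
  have hn1 : (1 : ℝ) < n := by exact_mod_cast hn
  have hN1 : (1 : ℝ) ≤ N := by exact_mod_cast hN
  have hlogn : 0 < Real.log n := Real.log_pos hn1
  set D : ℝ := Real.log N / Real.log n with hD
  have hD0 : 0 ≤ D := div_nonneg (Real.log_nonneg hN1) hlogn.le
  have hpow : (n : ℝ) ^ D = N := by
    rw [Real.rpow_def_of_pos (by linarith), hD, mul_div_cancel₀ _ hlogn.ne',
      Real.exp_log (by linarith)]
  have hle := MeasureTheory.Measure.hausdorffMeasure_le_liminf_sum (ι := fun L => T L) D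
    (closure S) (l := Filter.atTop) (fun L => ENNReal.ofReal (2 * r / (n : ℝ) ^ L))
    (by
      rw [← ENNReal.ofReal_zero]
      refine ENNReal.tendsto_ofReal ?_
      exact tendsto_const_nhds.div_atTop (tendsto_pow_atTop_atTop_of_one_lt hn1))
    (fun L t => Set.Icc ((t : ℝ) - r / (n : ℝ) ^ L) (t + r / (n : ℝ) ^ L))
    (Filter.Eventually.of_forall fun L t => by
      rw [Real.ediam_Icc]
      exact ENNReal.ofReal_le_ofReal (le_of_eq (by ring)))
    (Filter.Eventually.of_forall fun L => closure_minimal (fun x hx => by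
        obtain ⟨t, ht, hxt⟩ := hT L x hx
        rw [abs_le] at hxt
        exact Set.mem_iUnion.2 ⟨⟨t, ht⟩, by constructor <;> simp only <;> linarith⟩)
      (isClosed_iUnion_of_finite fun _ => isClosed_Icc))
  have hbound : MeasureTheory.Measure.hausdorffMeasure D (closure S)
      ≤ ENNReal.ofReal (c * (2 * r) ^ D) := by
    refine hle.trans (Filter.liminf_le_of_frequently_le' (Filter.Frequently.of_forall fun L => ?_))
    have hsum : ∀ t : T L, Metric.ediam
        (Set.Icc ((t : ℝ) - r / (n : ℝ) ^ L) (t + r / (n : ℝ) ^ L)) ^ D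
          = ENNReal.ofReal ((2 * r) ^ D / (N : ℝ) ^ L) := fun t => by
      rw [Real.ediam_Icc, ENNReal.ofReal_rpow_of_nonneg _ hD0]
      · rw [show (t : ℝ) + r / (n : ℝ) ^ L - (t - r / (n : ℝ) ^ L) = 2 * r / (n : ℝ) ^ L by ring,
          Real.div_rpow (by positivity) (by positivity), ← Real.rpow_natCast, ← Real.rpow_mul
          (by positivity), mul_comm (L : ℝ), Real.rpow_mul (by positivity), hpow,
          Real.rpow_natCast]
      · have : 0 ≤ r / (n : ℝ) ^ L := by positivity
        linarith
    rw [Finset.sum_congr rfl fun t _ => hsum t, Finset.sum_const, nsmul_eq_mul,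
      ← ENNReal.ofReal_natCast, ← ENNReal.ofReal_mul (by positivity)]
    refine ENNReal.ofReal_le_ofReal ?_
    have hc : ((Finset.univ : Finset (T L)).card : ℝ) ≤ c * (N : ℝ) ^ L := by
      rw [Finset.card_univ, Fintype.card_coe]
      exact_mod_cast hcard L
    calc _ ≤ (c * (N : ℝ) ^ L) * ((2 * r) ^ D / (N : ℝ) ^ L) := by gcongr
      _ = c * (2 * r) ^ D := by field_simp
  have := dimH_le_of_hausdorffMeasure_ne_top (s := closure S) (d := D.toNNReal) (by
    rw [Real.coe_toNNReal _ hD0]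
    exact (hbound.trans_lt ENNReal.ofReal_lt_top).ne)
  exact this

section carpet

variable {n m : ℕ} {Λ : Finset (ℕ × ℕ)}

theorem fst_lt_of_mem (hΛ : Λ ⊆ Finset.range n ×ˢ Finset.range m) {q : ℕ × ℕ} (hq : q ∈ Λ) :
    q.1 < n :=
  Finset.mem_range.1 (Finset.mem_product.1 (hΛ hq)).1

theorem snd_lt_of_mem (hΛ : Λ ⊆ Finset.range n ×ˢ Finset.range m) {q : ℕ × ℕ} (hq : q ∈ Λ) :
    q.2 < m :=
  Finset.mem_range.1 (Finset.mem_product.1 (hΛ hq)).2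

theorem BMCarpet_subset (hm : 2 ≤ m) (hn : 2 ≤ n) (hΛ : Λ ⊆ Finset.range n ×ˢ Finset.range m) :
    BMCarpet n m Λ ⊆ Set.Icc 0 1 ×ˢ Set.Icc 0 1 := by
  rintro ⟨x, y⟩ ⟨d, hd, rfl, rfl⟩
  exact ⟨⟨tsum_digits_nonneg (d := fun k => (d k).1),
    tsum_digits_le_one (d := fun k => (d k).1) hn fun k => fst_lt_of_mem hΛ (hd k)⟩,
    ⟨tsum_digits_nonneg (d := fun k => (d k).2),
    tsum_digits_le_one (d := fun k => (d k).2) hm fun k => snd_lt_of_mem hΛ (hd k)⟩⟩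

theorem BMCarpet_nonempty (hΛ : Λ.Nonempty) : (BMCarpet n m Λ).Nonempty := by
  obtain ⟨q, hq⟩ := hΛ
  exact ⟨(_, _), fun _ => q, fun _ => hq, rfl, rfl⟩

theorem one_le_maxRowCard (hΛ : Λ ⊆ Finset.range n ×ˢ Finset.range m) (hne : Λ.Nonempty) :
    1 ≤ maxRowCard m Λ := by
  obtain ⟨q, hq⟩ := hne
  refine le_trans ?_ (Finset.le_sup (f := fun j => (rowDigits Λ j).card)
    (Finset.mem_range.2 (snd_lt_of_mem hΛ hq)))
  exact Finset.card_pos.2 ⟨q.1, Finset.mem_image.2 ⟨q, Finset.mem_filter.2 ⟨hq, rfl⟩, rfl⟩⟩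

/-- A piece of the carpet of size `n ^ (-s)`, magnified by `n ^ s`, has its projection to the first
axis covered by few intervals of length `n ^ (-L)`, once `s` is large compared with `L`. -/
theorem exists_cover_of_small_piece (hm : 2 ≤ m) (hn : 2 ≤ n)
    (hΛ : Λ ⊆ Finset.range n ×ˢ Finset.range m) {P : Set (ℝ × ℝ)} (hP : P ⊆ BMCarpet n m Λ)
    (hPne : P.Nonempty) {s L : ℕ} (hsL : (m : ℝ) ^ (s + L) ≤ (n : ℝ) ^ s)
    (hdist : ∀ p ∈ P, ∀ q ∈ P,
      (n : ℝ) ^ s * |p.1 - q.1| ≤ 2 ∧ (n : ℝ) ^ s * |p.2 - q.2| ≤ 2) :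
    ∃ T : Finset ℝ, T.card ≤ 49 * maxRowCard m Λ ^ L ∧
      ∀ p ∈ P, ∃ t ∈ T, |(n : ℝ) ^ s * p.1 - t| ≤ 1 / (n : ℝ) ^ L := by
  obtain ⟨p₀, hp₀⟩ := hPne
  obtain ⟨d₀, hd₀, hx₀, hy₀⟩ := hP hp₀
  set Z₀ := digitPrefix n (fun k => (d₀ k).1) s
  set J₀ := digitPrefix m (fun k => (d₀ k).2) (s + L)
  have card7 : ∀ a : ℕ, (Finset.Icc (a - 3) (a + 3)).card ≤ 7 := fun a => by
    rw [Nat.card_Icc]; omega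
  refine ⟨(Finset.Icc (Z₀ - 3) (Z₀ + 3) ×ˢ
    (Finset.Icc (J₀ - 3) (J₀ + 3)).biUnion (rowBlocks n m Λ L)).image
      fun q => (q.1 : ℝ) + q.2 / (n : ℝ) ^ L, ?_, ?_⟩
  · refine Finset.card_image_le.trans ?_
    rw [Finset.card_product]
    have h1 : ((Finset.Icc (J₀ - 3) (J₀ + 3)).biUnion (rowBlocks n m Λ L)).card
        ≤ 7 * maxRowCard m Λ ^ L :=
      (Finset.card_biUnion_le_card_mul _ _ _ fun J _ => card_rowBlocks_le (by omega) Λ L J).trans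
        (Nat.mul_le_mul_right _ (card7 _))
    calc _ ≤ 7 * (7 * maxRowCard m Λ ^ L) := Nat.mul_le_mul (card7 _) h1
      _ = 49 * maxRowCard m Λ ^ L := by ring
  · intro p hp
    obtain ⟨d, hd, hx, hy⟩ := hP hp
    obtain ⟨hdx, hdy⟩ := hdist p hp p₀ hp₀
    obtain ⟨a, ha, hae⟩ := exists_digitPrefix_add_eq hΛ hd s L
    have hdn : ∀ k, (d k).1 < n := fun k => fst_lt_of_mem hΛ (hd k)
    have hZ := digitPrefix_mem_Icc (d := fun k => (d k).1) (d' := fun k => (d₀ k).1) hn hdn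
      (fun k => fst_lt_of_mem hΛ (hd₀ k)) (by rwa [hx, hx₀] at hdx)
    have hJ := digitPrefix_mem_Icc (d := fun k => (d k).2) (d' := fun k => (d₀ k).2) hm
      (fun k => snd_lt_of_mem hΛ (hd k)) (fun k => snd_lt_of_mem hΛ (hd₀ k)) (t := s + L)
      (by rw [hy, hy₀] at hdy
          exact (mul_le_mul_of_nonneg_right hsL (abs_nonneg _)).trans hdy)
    refine ⟨_, Finset.mem_image.2 ⟨(_, a), Finset.mem_product.2 ⟨hZ, Finset.mem_biUnion.2
      ⟨_, hJ, ha⟩⟩, rfl⟩, ?_⟩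
    have h1 := digitPrefix_le (d := fun k => (d k).1) hn hdn (s + L)
    have h2 := le_digitPrefix_add_one (d := fun k => (d k).1) hn hdn (s + L)
    rw [← hx, hae, pow_add] at h1 h2
    push_cast at h1 h2
    have hpos : (0 : ℝ) < (n : ℝ) ^ L := by positivity
    have h3 : (n : ℝ) ^ s * p.1 - ((digitPrefix n (fun k => (d k).1) s : ℝ) + a / (n : ℝ) ^ L)
        = ((n : ℝ) ^ s * (n : ℝ) ^ L * p.1
          - ((n : ℝ) ^ L * digitPrefix n (fun k => (d k).1) s + a)) / (n : ℝ) ^ L := by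
      field_simp
    simp only
    rw [h3, abs_of_nonneg (div_nonneg (by linarith) hpos.le)]
    gcongr
    linarith

/-- A linear form of gradient bounded away from zero for which the image of the carpet is covered
by few intervals of length `n ^ (-L)`, as long as `s` is large compared with `L`. -/
theorem exists_form_cover (hm : 2 ≤ m) (hn : 2 ≤ n)
    (hΛ : Λ ⊆ Finset.range n ×ˢ Finset.range m) (hne : Λ.Nonempty) {f : ℝ × ℝ → ℝ × ℝ} {l : ℝ}
    (hl0 : 0 < l) (hl1 : l < 1) (hf : IsSimilitude f l)
    (hsub : f '' BMCarpet n m Λ ⊆ BMCarpet n m Λ) (s : ℕ) :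
    ∃ v : ℝ × ℝ, l ^ 2 ≤ v.1 ^ 2 + v.2 ^ 2 ∧ v.1 ^ 2 + v.2 ^ 2 ≤ 1 ∧
      ∀ L : ℕ, (m : ℝ) ^ (s + L) ≤ (n : ℝ) ^ s →
        ∃ T : Finset ℝ, T.card ≤ 49 * maxRowCard m Λ ^ L ∧
          ∀ p ∈ BMCarpet n m Λ, ∃ t ∈ T, |v.1 * p.1 + v.2 * p.2 - t| ≤ 1 / (n : ℝ) ^ L := by
  have hn1 : (1 : ℝ) ≤ n := by exact_mod_cast (by omega : 1 ≤ n)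
  have hns : (0 : ℝ) < (n : ℝ) ^ s := by positivity
  obtain ⟨k, hk1, hk2⟩ := exists_nat_pow_near_of_lt_one (x := ((n : ℝ) ^ s)⁻¹)
    (by positivity) (inv_le_one_of_one_le₀ (one_le_pow₀ hn1)) hl0 hl1
  have hscale1 : (n : ℝ) ^ s * l ^ (k + 1) ≤ 1 := by
    have := mul_le_mul_of_nonneg_left hk1.le hns.le
    rwa [mul_inv_cancel₀ hns.ne'] at this
  have hscale2 : l ≤ (n : ℝ) ^ s * l ^ (k + 1) := by
    have := mul_le_mul_of_nonneg_left hk2 hns.le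
    rw [mul_inv_cancel₀ hns.ne'] at this
    rw [pow_succ, ← mul_assoc]
    exact le_mul_of_one_le_left hl0.le this
  have hfk := hf.iterate (k + 1)
  obtain ⟨A, B, E, hAB, hE⟩ := hfk.exists_fst_eq (pow_pos hl0 _)
  have hmaps : Set.MapsTo f^[k + 1] (BMCarpet n m Λ) (BMCarpet n m Λ) :=
    (Set.mapsTo_iff_image_subset.2 hsub).iterate _
  have hv : ((n : ℝ) ^ s * A) ^ 2 + ((n : ℝ) ^ s * B) ^ 2
      = ((n : ℝ) ^ s * l ^ (k + 1)) ^ 2 := by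
    rw [mul_pow, mul_pow, mul_pow, ← mul_add, hAB]
  refine ⟨((n : ℝ) ^ s * A, (n : ℝ) ^ s * B), ?_, ?_, fun L hL => ?_⟩
  · simp only [hv]
    gcongr
  · simp only [hv]
    exact pow_le_one₀ (by positivity) hscale1
  obtain ⟨T, hT, hcov⟩ := exists_cover_of_small_piece hm hn hΛ hmaps.image_subset
    ((BMCarpet_nonempty hne).image _) hL (by
      rintro _ ⟨p, hp, rfl⟩ _ ⟨q, hq, rfl⟩
      have hp' := BMCarpet_subset hm hn hΛ hp
      have hq' := BMCarpet_subset hm hn hΛ hq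
      obtain ⟨⟨hp1, hp2⟩, hp3, hp4⟩ := hp'
      obtain ⟨⟨hq1, hq2⟩, hq3, hq4⟩ := hq'
      have h1 := hfk.sq_dist p q
      have h2 : (p.1 - q.1) ^ 2 + (p.2 - q.2) ^ 2 ≤ 2 ^ 2 := by nlinarith
      have h3 : ∀ a b : ℝ, a ^ 2 + b ^ 2
          = (l ^ (k + 1)) ^ 2 * ((p.1 - q.1) ^ 2 + (p.2 - q.2) ^ 2) →
          (n : ℝ) ^ s * |a| ≤ 2 := fun a b hab => by
        refine abs_le_of_sq_le_sq' ?_ (by norm_num) |>.2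
        rw [mul_pow, sq_abs]
        calc ((n : ℝ) ^ s) ^ 2 * a ^ 2 ≤ ((n : ℝ) ^ s) ^ 2 * (a ^ 2 + b ^ 2) := by
              gcongr; nlinarith [sq_nonneg b]
          _ = ((n : ℝ) ^ s * l ^ (k + 1)) ^ 2 * ((p.1 - q.1) ^ 2 + (p.2 - q.2) ^ 2) := by
              rw [hab]; ring
          _ ≤ 1 ^ 2 * 2 ^ 2 := by gcongr
          _ = 2 ^ 2 := by norm_num
      exact ⟨h3 _ _ h1, h3 _ _ (by rw [add_comm]; exact h1)⟩)
  refine ⟨T.image fun t => t - (n : ℝ) ^ s * E, Finset.card_image_le.trans hT, fun p hp => ?_⟩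
  obtain ⟨t, ht, hpt⟩ := hcov _ ⟨p, hp, rfl⟩
  refine ⟨_, Finset.mem_image_of_mem _ ht, ?_⟩
  rw [hE] at hpt
  convert hpt using 2
  ring

/-- Some nonzero linear form maps the carpet into a compact set of dimension at most
`log N / log n`. -/
theorem exists_form_dimH_le (hm : 2 ≤ m) (hnm : m < n)
    (hΛ : Λ ⊆ Finset.range n ×ˢ Finset.range m) (hne : Λ.Nonempty) {f : ℝ × ℝ → ℝ × ℝ} {l : ℝ}
    (hl0 : 0 < l) (hl1 : l < 1) (hf : IsSimilitude f l)
    (hsub : f '' BMCarpet n m Λ ⊆ BMCarpet n m Λ) :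
    ∃ (v : ℝ × ℝ) (C : Set ℝ), 0 < v.1 ^ 2 + v.2 ^ 2 ∧ IsCompact C ∧
      dimH C ≤ ENNReal.ofReal (Real.log (maxRowCard m Λ) / Real.log n) ∧
      ∀ p ∈ BMCarpet n m Λ, v.1 * p.1 + v.2 * p.2 ∈ C := by
  have hn : 2 ≤ n := by omega
  choose w hw1 hw2 hw3 using exists_form_cover hm hn hΛ hne hl0 hl1 hf hsub
  obtain ⟨v, -, φ, hφ, hlim⟩ := (isCompact_Icc (a := ((-1 : ℝ), (-1 : ℝ)))
    (b := ((1 : ℝ), (1 : ℝ)))).tendsto_subseq (x := w) fun s => by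
      have h1 := abs_le_of_sq_le_sq' (a := (w s).1) (b := 1)
        (by nlinarith [hw2 s, sq_nonneg (w s).2]) (by norm_num)
      have h2 := abs_le_of_sq_le_sq' (a := (w s).2) (b := 1)
        (by nlinarith [hw2 s, sq_nonneg (w s).1]) (by norm_num)
      exact ⟨⟨h1.1, h2.1⟩, ⟨h1.2, h2.2⟩⟩
  have hlim1 : Filter.Tendsto (fun s => (w (φ s)).1) Filter.atTop (nhds v.1) :=
    (continuous_fst.tendsto v).comp hlim
  have hlim2 : Filter.Tendsto (fun s => (w (φ s)).2) Filter.atTop (nhds v.2) :=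
    (continuous_snd.tendsto v).comp hlim
  have hv : l ^ 2 ≤ v.1 ^ 2 + v.2 ^ 2 :=
    ge_of_tendsto' ((hlim1.pow 2).add (hlim2.pow 2)) fun s => hw1 (φ s)
  refine ⟨v, closure ((fun p : ℝ × ℝ => v.1 * p.1 + v.2 * p.2) '' BMCarpet n m Λ),
    by nlinarith [pow_pos hl0 2], ?_, ?_, fun p hp => subset_closure ⟨p, hp, rfl⟩⟩
  · have hcpt : IsCompact ((fun p : ℝ × ℝ => v.1 * p.1 + v.2 * p.2) ''
        (Set.Icc (0 : ℝ) 1 ×ˢ Set.Icc (0 : ℝ) 1)) :=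
      (isCompact_Icc.prod isCompact_Icc).image (by fun_prop)
    exact hcpt.closure_of_subset (Set.image_mono (BMCarpet_subset hm hn hΛ))
  · refine dimH_closure_le_of_covers (c := 49) (r := 2) hn (one_le_maxRowCard hΛ hne)
      (by norm_num) fun L => ?_
    have hm0 : (0 : ℝ) < m := by exact_mod_cast (by omega : 0 < m)
    have hε : (0 : ℝ) < 1 / (n : ℝ) ^ L / 2 := by positivity
    have hratio : Filter.Tendsto (fun s => ((n : ℝ) / m) ^ φ s) Filter.atTop Filter.atTop :=
      (tendsto_pow_atTop_atTop_of_one_lt ((one_lt_div hm0).2 (by exact_mod_cast hnm))).comp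
        hφ.tendsto_atTop
    obtain ⟨s, hs0, hs1, hs2⟩ := ((hratio.eventually_ge_atTop ((m : ℝ) ^ L)).and
      ((Metric.tendsto_nhds.1 hlim1 _ hε).and (Metric.tendsto_nhds.1 hlim2 _ hε))).exists
    rw [Real.dist_eq] at hs1 hs2
    obtain ⟨T, hT, hcov⟩ := hw3 (φ s) L (by
      rw [div_pow, le_div_iff₀ (by positivity)] at hs0
      rwa [add_comm, pow_add])
    refine ⟨T, hT, ?_⟩
    rintro _ ⟨p, hp, rfl⟩
    obtain ⟨t, ht, hpt⟩ := hcov p hp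
    refine ⟨t, ht, ?_⟩
    obtain ⟨⟨hp1, hp2⟩, hp3, hp4⟩ := BMCarpet_subset hm hn hΛ hp
    have e1 : |(w (φ s)).1 - v.1| * p.1 ≤ 1 / (n : ℝ) ^ L / 2 :=
      (mul_le_of_le_one_right (abs_nonneg _) hp2).trans hs1.le
    have e2 : |(w (φ s)).2 - v.2| * p.2 ≤ 1 / (n : ℝ) ^ L / 2 :=
      (mul_le_of_le_one_right (abs_nonneg _) hp4).trans hs2.le
    rw [← abs_of_nonneg hp1, ← abs_mul, abs_le] at e1
    rw [← abs_of_nonneg hp3, ← abs_mul, abs_le] at e2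
    rw [abs_le] at hpt
    have h2 : 2 / (n : ℝ) ^ L = 1 / (n : ℝ) ^ L + 1 / (n : ℝ) ^ L := by ring
    rw [h2, abs_le]
    constructor <;> simp only <;> linarith

end carpet

theorem isSimilitude_of_form (v : ℝ × ℝ) :
    IsSimilitude (fun p => (v.1 * p.1 + v.2 * p.2, -v.2 * p.1 + v.1 * p.2))
      (Real.sqrt (v.1 ^ 2 + v.2 ^ 2)) := fun x y => by
  rw [← Real.sqrt_mul (by positivity)]
  congr 1
  ring

theorem oblique_comp_of_form {v : ℝ × ℝ} (hv : 0 < v.1 ^ 2 + v.2 ^ 2) {f : ℝ × ℝ → ℝ × ℝ}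
    (hf : Oblique f)
    (hg : ¬ Oblique (fun p : ℝ × ℝ => (v.1 * p.1 + v.2 * p.2, -v.2 * p.1 + v.1 * p.2))) :
    Oblique ((fun p : ℝ × ℝ => (v.1 * p.1 + v.2 * p.2, -v.2 * p.1 + v.1 * p.2)) ∘ f) := by
  obtain ⟨h1, h2⟩ := hf
  obtain ⟨A, B⟩ := v
  have e1 : A * (f (1, 0)).1 + B * (f (1, 0)).2 - (A * (f (0, 0)).1 + B * (f (0, 0)).2)
    = A * ((f (1, 0)).1 - (f (0, 0)).1) + B * ((f (1, 0)).2 - (f (0, 0)).2) := by ring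
  have e2 : -B * (f (1, 0)).1 + A * (f (1, 0)).2 - (-B * (f (0, 0)).1 + A * (f (0, 0)).2)
    = -B * ((f (1, 0)).1 - (f (0, 0)).1) + A * ((f (1, 0)).2 - (f (0, 0)).2) := by ring
  simp only [Oblique, Function.comp_apply, e1, e2] at hg ⊢
  by_cases hA : A = 0
  · subst hA
    have hB : B ≠ 0 := by rintro rfl; simp at hv
    simp [hB, h1, h2]
  · have hB : B = 0 := by
      by_contra hB
      simp [hA, hB] at hg
    subst hB
    simp [hA, h1, h2]

theorem rescaling_lemma_contracting
    (n m : ℕ) (Λ : Finset (ℕ × ℕ))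
    (hm : 2 ≤ m) (hnm : m < n)
    (hΛsub : Λ ⊆ Finset.range n ×ˢ Finset.range m)
    (hΛ1 : 1 < Λ.card) (hΛ2 : Λ.card < m * n)
    (hrat : ∃ q : ℚ, Real.log n / Real.log m = (q : ℝ))
    (hline : ¬ OnALine (BMCarpet n m Λ))
    (f : ℝ × ℝ → ℝ × ℝ) (l : ℝ) (hl0 : 0 < l) (hl1 : l < 1)
    (hf : IsSimilitude f l)
    (hsub : f '' BMCarpet n m Λ ⊆ BMCarpet n m Λ) :
    ∃ (g : ℝ × ℝ → ℝ × ℝ) (lg : ℝ) (C : Set ℝ),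
      0 < lg ∧ IsSimilitude g lg ∧ IsCompact C ∧
      dimH C ≤ ENNReal.ofReal (Real.log (maxRowCard m Λ) / Real.log n) ∧
      g '' BMCarpet n m Λ ⊆ C ×ˢ (Set.univ : Set ℝ) ∧
      (Oblique f → Oblique g) := by
  obtain ⟨v, C, hv, hC, hdim, hmem⟩ := exists_form_dimH_le hm hnm hΛsub
    (Finset.card_pos.1 (by omega)) hl0 hl1 hf hsub
  have hsim := isSimilitude_of_form v
  by_cases hob : Oblique f → Oblique fun p : ℝ × ℝ =>
      (v.1 * p.1 + v.2 * p.2, -v.2 * p.1 + v.1 * p.2)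
  · refine ⟨_, _, C, Real.sqrt_pos.2 hv, hsim, hC, hdim, ?_, hob⟩
    rintro _ ⟨p, hp, rfl⟩
    exact ⟨hmem p hp, trivial⟩
  · rw [Classical.not_imp] at hob
    refine ⟨_, _, C, mul_pos (Real.sqrt_pos.2 hv) hl0, hsim.comp hf, hC, hdim, ?_,
      fun hfo => oblique_comp_of_form hv hfo hob.2⟩
    rintro _ ⟨p, hp, rfl⟩
    exact ⟨hmem _ (hsub ⟨p, hp, rfl⟩), trivial⟩
end
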